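/- arXiv:1112.5753 — 5 statements merged into one kernel-verified Lean document; each statement's English description precedes it below -/
import Mathlib

section
/- For every nonempty finite set S of natural numbers all of whose elements are at least 2, there exists a polynomial f in Int(ℤ) whose set of lengths L(f) is exactly S; that is, f has a factorization into n irreducible elements of Int(ℤ) if and only if n ∈ S. -/
open Polynomial

/-- The ring of integer-valued polynomials `Int(ℤ) = {f ∈ ℚ[X] | f(ℤ) ⊆ ℤ}`,
as a subring of ℚ[X]. -/
noncomputable def IntValued : Subring (Polynomial ℚ) where
  carrier := {f | ∀ c : ℤ, ∃ m : ℤ, f.eval (c : ℚ) = (m : ℚ)}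
  zero_mem' := fun c => ⟨0, by simp⟩
  one_mem' := fun c => ⟨1, by simp⟩
  add_mem' := by
    rintro f g hf hg c
    obtain ⟨m, hm⟩ := hf c
    obtain ⟨n, hn⟩ := hg c
    exact ⟨m + n, by simp [hm, hn]⟩
  mul_mem' := by
    rintro f g hf hg c
    obtain ⟨m, hm⟩ := hf c
    obtain ⟨n, hn⟩ := hg c
    exact ⟨m * n, by simp [hm, hn]⟩
  neg_mem' := by
    rintro f hf c
    obtain ⟨m, hm⟩ := hf c
    exact ⟨-m, by simp [hm]⟩

/-- A monic integer polynomial `g` can be approximated modulo `m` by an irreducible one that is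
close to `X ^ g.natDegree + m * P` modulo `w`. -/
lemma exists_irreducible_approx (g : ℤ[X]) (hg : g.Monic) (hd : 0 < g.natDegree) (m w P : ℤ)
    (hP : Prime P) (hPm : ¬ P ∣ m) (hw : P ^ 2 ∣ w) (hw1 : m ∣ w - 1) :
    ∃ F : ℤ[X], F.Monic ∧ F.natDegree = g.natDegree ∧ Irreducible F ∧
      (∀ c, m ∣ F.eval c - g.eval c) ∧ ∀ c, w ∣ F.eval c - (c ^ g.natDegree + m * P) := by
  set d := g.natDegree with hd_eq
  have hlt : (C w * (g - X ^ d) + C (m * P)).degree < (d : WithBot ℕ) := by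
    have h1 : (g - X ^ d).degree < (d : WithBot ℕ) := by
      have := degree_sub_lt_left (p := g) (q := X ^ d)
        (by rw [degree_X_pow, degree_eq_natDegree hg.ne_zero]) hg.ne_zero
        (by rw [hg.leadingCoeff, leadingCoeff_X_pow])
      rwa [degree_eq_natDegree hg.ne_zero] at this
    refine (degree_add_le _ _).trans_lt (max_lt ?_ ?_)
    · refine lt_of_le_of_lt ?_ h1
      rw [← smul_eq_C_mul]
      exact degree_smul_le _ _
    · exact degree_C_le.trans_lt (by exact_mod_cast hd)
  set F : ℤ[X] := X ^ d + (C w * (g - X ^ d) + C (m * P)) with hF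
  have hFm : F.Monic := monic_X_pow_add hlt
  have hFd : F.natDegree = d := by
    apply natDegree_eq_of_degree_eq_some
    rw [hF, degree_add_eq_left_of_degree_lt (by rwa [degree_X_pow]), degree_X_pow]
  have hPw : P ∣ w := (dvd_pow_self P two_ne_zero).trans hw
  refine ⟨F, hFm, hFd, ?_, fun c => ?_, fun c => ?_⟩
  · refine irreducible_of_eisenstein_criterion (P := Ideal.span {P})
      ((Ideal.span_singleton_prime hP.ne_zero).2 hP) ?_ ?_ ?_ ?_ hFm.isPrimitive
    · rw [hFm.leadingCoeff, Ideal.mem_span_singleton]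
      exact fun h => hP.not_isUnit (isUnit_of_dvd_one h)
    · intro n hn
      rw [degree_eq_natDegree hFm.ne_zero, hFd] at hn
      have hn : n < d := by exact_mod_cast hn
      rw [Ideal.mem_span_singleton]
      simp only [hF, coeff_add, coeff_X_pow, coeff_C_mul, coeff_C, hn.ne, if_false, zero_add]
      refine dvd_add (hPw.mul_right _) ?_
      split_ifs <;> simp
    · rw [degree_eq_natDegree hFm.ne_zero, hFd]
      exact_mod_cast hd
    · rw [Ideal.span_singleton_pow, Ideal.mem_span_singleton]
      simp only [hF, coeff_add, coeff_X_pow, coeff_C_mul, coeff_C, hd.ne, if_false, zero_add,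
        if_true]
      intro h
      have h2 := (dvd_add_right (hw.mul_right _)).1 h
      rw [pow_two] at h2
      exact hPm (Int.dvd_of_mul_dvd_mul_right hP.ne_zero h2)
  · have : F.eval c - g.eval c = (w - 1) * (g.eval c - c ^ d) + m * P := by
      simp [hF]; ring
    rw [this]
    exact dvd_add (hw1.mul_right _) (dvd_mul_right _ _)
  · have : F.eval c - (c ^ d + m * P) = w * (g.eval c - c ^ d) := by
      simp [hF]
    rw [this]
    exact dvd_mul_right _ _

lemma prime_le_natDegree_of_dvd_eval {A : ℤ[X]} (hA : A.Monic) {q : ℕ} (hq : q.Prime)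
    (h : ∀ c : ℤ, (q : ℤ) ∣ A.eval c) : q ≤ A.natDegree := by
  have := Fact.mk hq
  by_contra! hlt
  have hm : (A.map (Int.castRingHom (ZMod q))).Monic := hA.map _
  refine hm.ne_zero (eq_zero_of_natDegree_lt_card_of_eval_eq_zero _ (f := id)
    Function.injective_id (fun i => ?_) ?_)
  · obtain ⟨c, rfl⟩ := ZMod.intCast_surjective i
    have := eval_intCast_map (Int.castRingHom (ZMod q)) A c
    simp only [id]
    rw [this]
    exact (ZMod.intCast_zmod_eq_zero_iff_dvd _ _).2 (h c)
  · rw [ZMod.card, hA.natDegree_map]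
    exact hlt

/-- Irreducible monic integer polynomials with prescribed roots modulo `p`, whose product has
fixed divisor dividing `p`. -/
lemma exists_irreducible_family {ι : Type*} [Fintype ι] [DecidableEq ι] (p : ℕ) (hp : p.Prime)
    (Z : ι → Finset ℕ) (hZp : ∀ i, ∀ c ∈ Z i, c < p) (hZ : ∀ i, (Z i).Nonempty)
    (i₀ : ι) (h0 : ∀ i, 0 ∈ Z i ↔ i = i₀) :
    ∃ F : ι → ℤ[X], (∀ i, (F i).Monic ∧ Irreducible (F i)) ∧
      (∀ T : Finset ι, (∀ c : ℤ, (p : ℤ) ∣ ∏ i ∈ T, (F i).eval c) ↔ ∀ c < p, ∃ i ∈ T, c ∈ Z i) ∧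
      ∀ d : ℕ, (∀ c : ℤ, (d : ℤ) ∣ ∏ i, (F i).eval c) → d ∣ p := by
  set g : ι → ℤ[X] := fun i => ∏ c ∈ Z i, (X - C (c : ℤ)) with hg
  have hgm : ∀ i, (g i).Monic := fun i => monic_prod_of_monic _ _ fun c _ => monic_X_sub_C _
  have hgd : ∀ i, (g i).natDegree = (Z i).card := fun i =>
    natDegree_finsetProd_X_sub_C_eq_card _ _
  set D := ∑ i, (Z i).card with hD
  obtain ⟨P, hPle, hP⟩ := Nat.exists_infinite_primes (D + p + 1)
  set M := ∏ q ∈ (Finset.range (D + 1)).filter (fun q => q.Prime ∧ q ≠ p), q with hM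
  have hpP : p ≠ P := by omega
  have hcop : IsCoprime ((p : ℤ) ^ 2) ((P : ℤ) ^ 2 * M) := by
    apply IsCoprime.pow_left
    refine IsCoprime.mul_right (IsCoprime.pow_right ?_) ?_
    · exact Nat.isCoprime_iff_coprime.2 ((Nat.coprime_primes hp hP).2 hpP)
    · rw [hM, Nat.cast_prod]
      refine IsCoprime.prod_right fun q hq => ?_
      rw [Finset.mem_filter] at hq
      exact Nat.isCoprime_iff_coprime.2 ((Nat.coprime_primes hp hq.2.1).2 hq.2.2.symm)
  obtain ⟨a, b, hab⟩ := hcop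
  set w : ℤ := b * ((P : ℤ) ^ 2 * M) with hw
  have hPint : Prime (P : ℤ) := Nat.prime_iff_prime_int.1 hP
  have hpint : Prime (p : ℤ) := Nat.prime_iff_prime_int.1 hp
  have key : ∀ i, ∃ F : ℤ[X], F.Monic ∧ F.natDegree = (g i).natDegree ∧ Irreducible F ∧
      (∀ c, (p : ℤ) ^ 2 ∣ F.eval c - (g i).eval c) ∧
      ∀ c, w ∣ F.eval c - (c ^ (g i).natDegree + (p : ℤ) ^ 2 * P) := fun i => by
    refine exists_irreducible_approx (g i) (hgm i) ?_ _ w P hPint ?_ ?_ ?_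
    · rw [hgd]; exact (hZ i).card_pos
    · intro h
      have := hPint.dvd_of_dvd_pow h
      exact hpP ((Nat.prime_dvd_prime_iff_eq hP hp).1 (Int.natCast_dvd_natCast.1 this)).symm
    · exact (dvd_mul_right _ _).mul_left _
    · exact ⟨-a, by linear_combination hab⟩
  choose F hFm hFd hFi hFp hFw using key
  have hroot : ∀ i (c : ℤ), (p : ℤ) ∣ (F i).eval c ↔ (c % p).toNat ∈ Z i := by
    intro i c
    have hpos : (0 : ℤ) < p := by exact_mod_cast hp.pos
    have h1 : (p : ℤ) ∣ (F i).eval c - (g i).eval c :=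
      (dvd_pow_self _ two_ne_zero).trans (hFp i c)
    rw [dvd_iff_dvd_of_dvd_sub h1, hg]
    simp only [eval_prod, eval_sub, eval_X, eval_C]
    rw [hpint.dvd_finsetProd_iff]
    have hnn := Int.emod_nonneg c hpos.ne'
    have hltp := Int.emod_lt_of_pos c hpos
    constructor
    · rintro ⟨s, hs, hds⟩
      have hsp := hZp i s hs
      have : c % p = s := (Int.modEq_iff_dvd.2 hds).symm.eq.trans
        (Int.emod_eq_of_lt (by omega) (by omega))
      rw [this]; simpa using hs
    · intro h
      refine ⟨_, h, ?_⟩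
      rw [Int.toNat_of_nonneg hnn]
      exact Int.dvd_self_sub_emod
  refine ⟨F, fun i => ⟨hFm i, hFi i⟩, fun T => ?_, fun d hd => ?_⟩
  · constructor
    · intro h c hc
      obtain ⟨i, hi, hdi⟩ := (hpint.dvd_finsetProd_iff _).1 (h c)
      refine ⟨i, hi, ?_⟩
      rw [hroot] at hdi
      rwa [← Int.natCast_mod, Int.toNat_natCast, Nat.mod_eq_of_lt hc] at hdi
    · intro h c
      have hpos : (0 : ℤ) < p := by exact_mod_cast hp.pos
      have hnn := Int.emod_nonneg c hpos.ne'
      have hltp := Int.emod_lt_of_pos c hpos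
      obtain ⟨i, hi, hci⟩ := h (c % p).toNat (by omega)
      exact (hpint.dvd_finsetProd_iff _).2 ⟨i, hi, (hroot i c).2 hci⟩
  · have hd2 : ¬ p ^ 2 ∣ d := by
      intro h2
      have h3 : (p : ℤ) ^ 2 ∣ ∏ i, (F i).eval (p : ℤ) :=
        (by exact_mod_cast h2 : ((p : ℤ) ^ 2) ∣ d).trans (hd p)
      rw [← Finset.mul_prod_erase _ _ (Finset.mem_univ i₀)] at h3
      have h4 : ¬ (p : ℤ) ∣ ∏ i ∈ Finset.univ.erase i₀, (F i).eval (p : ℤ) := by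
        rw [hpint.dvd_finsetProd_iff]
        rintro ⟨i, hi, hdi⟩
        rw [hroot] at hdi
        simp only [EuclideanDomain.mod_self, Int.toNat_zero, h0] at hdi
        simp [hdi] at hi
      have h5 := hpint.pow_dvd_of_dvd_mul_right 2 h4 h3
      rw [dvd_iff_dvd_of_dvd_sub (hFp i₀ p), hg] at h5
      simp only [eval_prod, eval_sub, eval_X, eval_C] at h5
      rw [← Finset.mul_prod_erase _ _ ((h0 i₀).2 rfl), pow_two, Nat.cast_zero, sub_zero] at h5
      have h6 := Int.dvd_of_mul_dvd_mul_left hpint.ne_zero h5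
      obtain ⟨s, hs, hds⟩ := (hpint.dvd_finsetProd_iff _).1 h6
      rw [Finset.mem_erase] at hs
      have h7 : (p : ℤ) ∣ s := (dvd_sub_right (dvd_refl _)).1 hds
      exact hs.1 (Nat.eq_zero_of_dvd_of_lt (by exact_mod_cast h7) (hZp i₀ s hs.2))
    have hd0 : d ≠ 0 := by rintro rfl; simp at hd2
    have hpr : ∀ {q : ℕ}, q.Prime → q ∣ d → q = p := by
      intro q hq hqd
      by_contra hne
      have hqA : ∀ c : ℤ, (q : ℤ) ∣ ∏ i, (F i).eval c := fun c =>
        (by exact_mod_cast hqd : (q : ℤ) ∣ d).trans (hd c)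
      have hqint : Prime (q : ℤ) := Nat.prime_iff_prime_int.1 hq
      have hqD : q ≤ D := by
        have := prime_le_natDegree_of_dvd_eval (A := ∏ i, F i)
          (monic_prod_of_monic _ _ fun i _ => hFm i) hq (fun c => by
            rw [eval_prod]; exact hqA c)
        rw [natDegree_prod_of_monic _ _ fun i _ => hFm i] at this
        simpa only [hFd, hgd] using this
      have hqM : q ∣ M := Finset.dvd_prod_of_mem (fun q => q)
        (Finset.mem_filter.2 ⟨Finset.mem_range.2 (by omega), hq, hne⟩)
      have hqw : (q : ℤ) ∣ w :=
        ((by exact_mod_cast hqM : (q : ℤ) ∣ M).mul_left _).mul_left _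
      obtain ⟨i, -, hi⟩ := (hqint.dvd_finsetProd_iff _).1 (hqA 0)
      rw [dvd_iff_dvd_of_dvd_sub (hqw.trans (hFw i 0)), zero_pow (by
        rw [hgd]; exact (hZ i).card_pos.ne'), zero_add] at hi
      rcases hqint.dvd_or_dvd hi with h | h
      · have := hqint.dvd_of_dvd_pow h
        exact hne ((Nat.prime_dvd_prime_iff_eq hq hp).1 (Int.natCast_dvd_natCast.1 this))
      · have := (Nat.prime_dvd_prime_iff_eq hq hP).1 (Int.natCast_dvd_natCast.1 h)
        omega
    have hpow := Nat.eq_prime_pow_of_unique_prime_dvd hd0 hpr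
    rw [hpow] at hd2 ⊢
    have : d.primeFactorsList.length ≤ 1 := by
      by_contra! h
      exact hd2 (pow_dvd_pow p h)
    simpa using pow_dvd_pow p this

lemma exists_partition_of_prod_eq {K ι J : Type*} [Field K] [Fintype J] [Nonempty J]
    [DecidableEq J] [DecidableEq ι] (F : ι → K[X]) (hF : ∀ i, Irreducible (F i)) (T : Finset ι) :
    ∀ (g : J → K[X]) (c : K), c ≠ 0 → ∏ j, g j = C c * ∏ i ∈ T, F i →
      ∃ (a : ι → J) (e : J → K), ∀ j, g j = C (e j) * ∏ i ∈ T with a i = j, F i := by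
  induction T using Finset.induction_on with
  | empty =>
    intro g c hc h
    rw [Finset.prod_empty, mul_one] at h
    have hu : IsUnit (∏ j, g j) := h ▸ isUnit_C.2 hc.isUnit
    have : ∀ j, ∃ e : K, g j = C e := fun j => by
      have := isUnit_of_dvd_unit (Finset.dvd_prod_of_mem g (Finset.mem_univ j)) hu
      obtain ⟨e, -, he⟩ := Polynomial.isUnit_iff.1 this
      exact ⟨e, he.symm⟩
    choose e he using this
    exact ⟨fun _ => Classical.arbitrary J, e, fun j => by simpa using he j⟩
  | insert i T hi ih =>
    intro g c hc h
    rw [Finset.prod_insert hi] at h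
    have hdvd : F i ∣ ∏ j, g j := h ▸ (dvd_mul_right _ _).mul_left _
    obtain ⟨j, -, q, hq⟩ := (hF i).prime.exists_mem_finset_dvd hdvd
    have hprod : ∏ k, Function.update g j q k = C c * ∏ i ∈ T, F i := by
      apply mul_left_cancel₀ (hF i).ne_zero
      rw [Finset.prod_update_of_mem (Finset.mem_univ j), ← mul_assoc, ← hq,
        ← Finset.erase_eq, Finset.mul_prod_erase _ _ (Finset.mem_univ j), h]
      ring
    obtain ⟨a, e, hae⟩ := ih _ c hc hprod
    refine ⟨Function.update a i j, e, fun k => ?_⟩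
    have hT : (T.filter fun i' => Function.update a i j i' = k) = T.filter fun i' => a i' = k :=
      Finset.filter_congr fun i' hi' => by
        rw [Function.update_of_ne (by rintro rfl; exact hi hi')]
    rw [Finset.filter_insert, hT, Function.update_self]
    have hk := hae k
    split_ifs with hjk
    · subst hjk
      rw [Function.update_self] at hk
      rw [Finset.prod_insert (by simp [hi]), hq, hk]
      ring
    · rwa [Function.update_of_ne (Ne.symm hjk)] at hk

lemma exists_int_eq_or_of_mem_intValued {ι : Type*} [Fintype ι] (F : ι → ℤ[X]) {p : ℕ}
    (hp : p.Prime) (hd : ∀ d : ℕ, (∀ c : ℤ, (d : ℤ) ∣ ∏ i, (F i).eval c) → d ∣ p)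
    (T : Finset ι) (q : ℚ)
    (h : C q * ∏ i ∈ T, (F i).map (Int.castRingHom ℚ) ∈ IntValued) :
    (∃ m : ℤ, q = m) ∨ (∃ m : ℤ, q = m / p) ∧ ∀ c : ℤ, (p : ℤ) ∣ ∏ i ∈ T, (F i).eval c := by
  have hden : ∀ c : ℤ, (q.den : ℤ) ∣ ∏ i ∈ T, (F i).eval c := by
    intro c
    obtain ⟨m, hm⟩ := h c
    have hev : ∀ i, ((F i).map (Int.castRingHom ℚ)).eval (c : ℚ) = ((F i).eval c : ℤ) :=
      fun i => eval_intCast_map (Int.castRingHom ℚ) (F i) c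
    simp only [eval_mul, eval_C, eval_prod, hev] at hm
    have hq0 : (q.den : ℚ) ≠ 0 := by exact_mod_cast q.den_nz
    have h1 : (q.num : ℚ) * ((∏ i ∈ T, (F i).eval c : ℤ) : ℚ) = q.den * m := by
      rw [← Rat.mul_den_eq_num q, ← hm]
      push_cast
      ring
    have h2 : q.num * ∏ i ∈ T, (F i).eval c = q.den * m := by exact_mod_cast h1
    have hc : IsCoprime (q.den : ℤ) q.num :=
      (Int.isCoprime_iff_nat_coprime.2 (by simpa using q.reduced)).symm
    exact hc.dvd_of_dvd_mul_left ⟨m, h2⟩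
  have hdp : q.den ∣ p := hd _ fun c => (hden c).trans
    (Finset.prod_dvd_prod_of_subset _ _ _ (Finset.subset_univ T))
  rcases (Nat.dvd_prime hp).1 hdp with h1 | h1
  · exact Or.inl ⟨q.num, (Rat.den_eq_one_iff q).1 h1 |>.symm⟩
  · refine Or.inr ⟨⟨q.num, ?_⟩, fun c => h1 ▸ hden c⟩
    conv_lhs => rw [← Rat.num_div_den q, h1]

/-- Every factorization of `(1 / p) * ∏ i ∈ T, F i` into integer-valued polynomials arises, up to
signs, from a partition of `T`. -/
lemma exists_partition_of_prod_eq_intValued {ι J : Type*} [Fintype ι] [DecidableEq ι] [Fintype J]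
    [Nonempty J] [DecidableEq J] (F : ι → ℤ[X]) (hF : ∀ i, (F i).Monic ∧ Irreducible (F i)) {p : ℕ}
    (hp : p.Prime) (hd : ∀ d : ℕ, (∀ c : ℤ, (d : ℤ) ∣ ∏ i, (F i).eval c) → d ∣ p)
    (i₀ : ι) (hi₀ : ∀ T : Finset ι, (∀ c : ℤ, (p : ℤ) ∣ ∏ i ∈ T, (F i).eval c) → i₀ ∈ T)
    (T : Finset ι) (g : J → ℚ[X]) (hg : ∀ j, g j ∈ IntValued)
    (h : ∏ j, g j = C (p : ℚ)⁻¹ * ∏ i ∈ T, (F i).map (Int.castRingHom ℚ)) :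
    ∃ (a : ι → J) (s : J → ℤˣ),
      (∀ c : ℤ, (p : ℤ) ∣ ∏ i ∈ T with a i = a i₀, (F i).eval c) ∧
      ∀ j, g j = C (((s j : ℤ) : ℚ) * if j = a i₀ then (p : ℚ)⁻¹ else 1) *
        ∏ i ∈ T with a i = j, (F i).map (Int.castRingHom ℚ) := by
  have hp0 : (p : ℚ) ≠ 0 := by exact_mod_cast hp.ne_zero
  have hirr : ∀ i, Irreducible ((F i).map (Int.castRingHom ℚ)) := fun i =>
    ((hF i).1.irreducible_iff_irreducible_map_fraction_map (K := ℚ)).1 (hF i).2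
  obtain ⟨a, e, hae⟩ := exists_partition_of_prod_eq _ hirr T g _ (inv_ne_zero hp0) h
  have hcases := fun j => exists_int_eq_or_of_mem_intValued F hp hd (T.filter fun i => a i = j) (e j)
    (hae j ▸ hg j)
  have hprod : ∏ j, e j = (p : ℚ)⁻¹ := by
    have hne : ∏ i ∈ T, (F i).map (Int.castRingHom ℚ) ≠ 0 :=
      Finset.prod_ne_zero_iff.2 fun i _ => (hirr i).ne_zero
    rw [Finset.prod_congr rfl fun j _ => hae j, Finset.prod_mul_distrib,
      Finset.prod_fiberwise] at h
    have := mul_right_cancel₀ hne h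
    rw [← map_prod] at this
    exact C_injective this
  have int_of_ne : ∀ j, j ≠ a i₀ → ∃ m : ℤ, e j = m := by
    intro j hj
    rcases hcases j with hm | ⟨-, hgood⟩
    · exact hm
    · exact absurd (Finset.mem_filter.1 (hi₀ _ hgood)).2.symm hj
  have hnotall : ¬ ∀ j, ∃ m : ℤ, e j = m := by
    intro hall
    choose m hm using hall
    have h1 : (p : ℚ) * ∏ j, (m j : ℚ) = 1 := by
      rw [← Finset.prod_congr rfl fun j _ => hm j, hprod, mul_inv_cancel₀ hp0]
    have h2 : (p : ℤ) * ∏ j, m j = 1 := by exact_mod_cast h1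
    exact (Nat.prime_iff_prime_int.1 hp).not_isUnit (IsUnit.of_mul_eq_one _ h2)
  have hspecial : (∃ m : ℤ, e (a i₀) = m / p) ∧
      ∀ c : ℤ, (p : ℤ) ∣ ∏ i ∈ T with a i = a i₀, (F i).eval c := by
    rcases hcases (a i₀) with hm | hm
    · refine absurd (fun j => ?_) hnotall
      by_cases hj : j = a i₀
      · rwa [hj]
      · exact int_of_ne j hj
    · exact hm
  have hex : ∀ j, ∃ m : ℤ, e j = m * if j = a i₀ then (p : ℚ)⁻¹ else 1 := by
    intro j
    split_ifs with hj
    · obtain ⟨m, hm⟩ := hspecial.1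
      exact ⟨m, by rw [hj, hm, div_eq_mul_inv]⟩
    · simpa using int_of_ne j hj
  choose m hm using hex
  have hm1 : ∏ j, m j = 1 := by
    rw [Finset.prod_congr rfl fun j _ => hm j, Finset.prod_mul_distrib,
      Finset.prod_ite_eq' Finset.univ (a i₀) (fun _ => (p : ℚ)⁻¹), if_pos (Finset.mem_univ _)]
      at hprod
    have := mul_right_cancel₀ (inv_ne_zero hp0) (hprod.trans (one_mul _).symm)
    exact_mod_cast this
  have hunit : ∀ j, IsUnit (m j) := fun j =>
    isUnit_of_dvd_one (hm1 ▸ Finset.dvd_prod_of_mem m (Finset.mem_univ j))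
  refine ⟨a, fun j => (hunit j).unit, hspecial.2, fun j => ?_⟩
  rw [IsUnit.unit_spec, ← hm j]
  exact hae j

lemma not_isUnit_of_coe_eq {ι : Type*} (F : ι → ℚ[X]) (hF : ∀ i, Irreducible (F i))
    (T : Finset ι) (hT : T.Nonempty) (q : ℚ) (x : IntValued)
    (hx : (x : ℚ[X]) = C q * ∏ i ∈ T, F i) : ¬ IsUnit x := by
  intro hu
  have h1 : IsUnit (x : ℚ[X]) := hu.map IntValued.subtype
  obtain ⟨i, hi⟩ := hT
  exact (hF i).not_isUnit (isUnit_of_dvd_unit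
    (hx ▸ (Finset.dvd_prod_of_mem F hi).mul_left _) h1)

lemma isUnit_of_coe_eq_C (x : IntValued) (s : ℤ) (hs : IsUnit s)
    (hx : (x : ℚ[X]) = C (s : ℚ)) : IsUnit x := by
  refine IsUnit.of_mul_eq_one x (Subtype.ext ?_)
  rcases Int.isUnit_iff.1 hs with rfl | rfl <;> simp [hx]

lemma map_mem_intValued (F : ℤ[X]) : F.map (Int.castRingHom ℚ) ∈ IntValued := fun c =>
  ⟨F.eval c, eval_intCast_map (Int.castRingHom ℚ) F c⟩

lemma C_intCast_mem_intValued (m : ℤ) : C (m : ℚ) ∈ IntValued := fun _ => ⟨m, by simp⟩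

lemma coe_prod_intValued {J : Type*} (g : J → IntValued) (s : Finset J) :
    ((∏ j ∈ s, g j : IntValued) : ℚ[X]) = ∏ j ∈ s, (g j : ℚ[X]) :=
  map_prod IntValued.subtype g s

lemma prod_map_mem_intValued {ι : Type*} (F : ι → ℤ[X]) (T : Finset ι) :
    ∏ i ∈ T, (F i).map (Int.castRingHom ℚ) ∈ IntValued :=
  Subring.prod_mem _ fun i _ => map_mem_intValued (F i)

lemma inv_mul_prod_map_mem_intValued {ι : Type*} (F : ι → ℤ[X]) {p : ℕ} (hp : p.Prime)
    (T : Finset ι) (hT : ∀ c : ℤ, (p : ℤ) ∣ ∏ i ∈ T, (F i).eval c) :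
    C (p : ℚ)⁻¹ * ∏ i ∈ T, (F i).map (Int.castRingHom ℚ) ∈ IntValued := by
  intro c
  obtain ⟨m, hm⟩ := hT c
  have hp0 : (p : ℚ) ≠ 0 := by exact_mod_cast hp.ne_zero
  have hev : ∀ i, ((F i).map (Int.castRingHom ℚ)).eval (c : ℚ) = ((F i).eval c : ℤ) :=
    fun i => eval_intCast_map (Int.castRingHom ℚ) (F i) c
  refine ⟨m, ?_⟩
  simp only [eval_mul, eval_C, eval_prod, hev]
  rw [← Int.cast_prod, hm]
  push_cast
  field_simp

/-- The lengths of the factorizations of `(1 / p) * ∏ i, F i` are determined by the minimal sets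
`T` for which `p` divides all values of `∏ i ∈ T, F i`. -/
lemma exists_lengths_iff {ι : Type*} [Fintype ι] [DecidableEq ι]
    (F : ι → ℤ[X]) (hF : ∀ i, (F i).Monic ∧ Irreducible (F i)) {p : ℕ}
    (hp : p.Prime) (hd : ∀ d : ℕ, (∀ c : ℤ, (d : ℤ) ∣ ∏ i, (F i).eval c) → d ∣ p)
    (good : Finset ι → Prop)
    (hgood : ∀ T : Finset ι, (∀ c : ℤ, (p : ℤ) ∣ ∏ i ∈ T, (F i).eval c) ↔ good T)
    (huniv : good Finset.univ) (i₀ : ι) (hi₀ : ∀ T : Finset ι, good T → i₀ ∈ T) :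
    ∃ f : IntValued, ∀ n : ℕ,
      (∃ l : Multiset IntValued, Multiset.card l = n ∧ (∀ g ∈ l, Irreducible g) ∧ l.prod = f)
        ↔ ∃ T : Finset ι, good T ∧ (∀ i ∈ T, ¬ good (T.erase i)) ∧ n = Tᶜ.card + 1 := by
  have hmono : ∀ S T : Finset ι, S ⊆ T → good S → good T := fun S T hST hS =>
    (hgood T).1 fun c => ((hgood S).2 hS c).trans (Finset.prod_dvd_prod_of_subset _ _ _ hST)
  have hi₀' : ∀ T : Finset ι, (∀ c : ℤ, (p : ℤ) ∣ ∏ i ∈ T, (F i).eval c) → i₀ ∈ T :=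
    fun T hT => hi₀ T ((hgood T).1 hT)
  have hirr : ∀ i, Irreducible ((F i).map (Int.castRingHom ℚ)) := fun i =>
    ((hF i).1.irreducible_iff_irreducible_map_fraction_map (K := ℚ)).1 (hF i).2
  set f : IntValued := ⟨C (p : ℚ)⁻¹ * ∏ i, (F i).map (Int.castRingHom ℚ),
    inv_mul_prod_map_mem_intValued F hp _ ((hgood _).2 huniv)⟩ with hf
  have hpart := fun {J : Type} [Fintype J] [Nonempty J] [DecidableEq J] =>
    exists_partition_of_prod_eq_intValued (J := J) F hF hp hd i₀ hi₀'
  refine ⟨f, fun n => ⟨?_, ?_⟩⟩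
  · rintro ⟨l, rfl, hl, hlf⟩
    induction l using Quotient.inductionOn with | _ L
    simp only [Multiset.quot_mk_to_coe, Multiset.mem_coe, Multiset.prod_coe,
      Multiset.coe_card] at hl hlf ⊢
    have hLne : Nonempty (Fin L.length) := by
      rw [← Fin.pos_iff_nonempty, List.length_pos_iff]
      rintro rfl
      exact not_isUnit_of_coe_eq _ hirr Finset.univ ⟨i₀, Finset.mem_univ _⟩ _ f rfl
        (hlf ▸ isUnit_one)
    have hgirr : ∀ j, Irreducible (L.get j) := fun j => hl _ (L.get_mem j)
    obtain ⟨a, s, hag, has⟩ := hpart Finset.univ (fun j => (L.get j : ℚ[X]))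
      (fun j => (L.get j).2) (by
        rw [← coe_prod_intValued, show ∏ j, L.get j = f from by rw [← hlf]; simp])
    set T : Finset ι := Finset.univ.filter fun i => a i = a i₀ with hT
    have hfib : ∀ j, j ≠ a i₀ → ∃ i, ∀ i', a i' = j ↔ i' = i := by
      intro j hj
      have hj' := has j
      rw [if_neg hj, mul_one] at hj'
      obtain ⟨i, hi⟩ : (Finset.univ.filter fun i => a i = j).Nonempty := by
        rw [Finset.nonempty_iff_ne_empty]
        intro hempty
        rw [hempty, Finset.prod_empty, mul_one] at hj'
        exact (hgirr j).not_isUnit (isUnit_of_coe_eq_C _ _ (s j).isUnit hj')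
      refine ⟨i, fun i' => ⟨fun hi' => ?_, by rintro rfl; exact (Finset.mem_filter.1 hi).2⟩⟩
      by_contra hne
      set U := (Finset.univ.filter fun i => a i = j) with hU
      have hi'U : i' ∈ U.erase i := by simp [hU, hne, hi']
      have hmem : C ((s j : ℤ) : ℚ) * ∏ i ∈ U.erase i, (F i).map (Int.castRingHom ℚ) ∈ IntValued :=
        mul_mem (C_intCast_mem_intValued _)
          (prod_map_mem_intValued _ _)
      have hfac : L.get j = ⟨_, map_mem_intValued (F i)⟩ * ⟨_, hmem⟩ := by
        apply Subtype.ext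
        rw [hj', ← Finset.mul_prod_erase _ _ hi]
        simp only [Subring.coe_mul]
        ring
      rcases (hgirr j).isUnit_or_isUnit hfac with hu | hu
      · exact not_isUnit_of_coe_eq _ hirr {i} ⟨i, by simp⟩ 1 _ (by simp) hu
      · exact not_isUnit_of_coe_eq _ hirr _ ⟨i', hi'U⟩ _ _ rfl hu
    refine ⟨T, (hgood T).1 hag, fun i hi hgi => ?_, ?_⟩
    · have hmem : C (((s (a i₀) : ℤ) : ℚ)) *
          (C (p : ℚ)⁻¹ * ∏ i ∈ T.erase i, (F i).map (Int.castRingHom ℚ)) ∈ IntValued :=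
        mul_mem (C_intCast_mem_intValued _)
          (inv_mul_prod_map_mem_intValued F hp _ ((hgood _).2 hgi))
      have hfac : L.get (a i₀) = ⟨_, map_mem_intValued (F i)⟩ * ⟨_, hmem⟩ := by
        apply Subtype.ext
        rw [has (a i₀), if_pos rfl, ← Finset.mul_prod_erase _ _ hi]
        simp only [Subring.coe_mul, C_mul]
        ring
      rcases (hgirr _).isUnit_or_isUnit hfac with hu | hu
      · exact not_isUnit_of_coe_eq _ hirr {i} ⟨i, by simp⟩ 1 _ (by simp) hu
      · refine not_isUnit_of_coe_eq _ hirr _ ⟨i₀, hi₀ _ hgi⟩ (((s (a i₀) : ℤ) : ℚ) * (p : ℚ)⁻¹) _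
          ?_ hu
        simp only [C_mul]
        ring
    · have hcard : Tᶜ.card = (Finset.univ.erase (a i₀)).card := by
        refine Finset.card_bij (fun i _ => a i) (fun i hi => ?_) (fun i hi i' hi' h => ?_)
          fun j hj => ?_
        · simpa [hT] using hi
        · obtain ⟨k, hk⟩ := hfib (a i') (by simpa [hT] using hi')
          rw [(hk i).1 h, (hk i').1 rfl]
        · obtain ⟨k, hk⟩ := hfib j (by simpa using hj)
          have := (hk k).2 rfl
          exact ⟨k, by simpa [hT, this] using hj, this⟩
      have hpos : 0 < L.length := Fin.pos_iff_nonempty.2 hLne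
      rw [hcard, Finset.card_erase_of_mem (Finset.mem_univ _), Finset.card_univ, Fintype.card_fin]
      omega
  · rintro ⟨T, hT, hmin, rfl⟩
    set h : IntValued := ⟨_, inv_mul_prod_map_mem_intValued F hp T ((hgood T).2 hT)⟩ with hh
    set G : ι → IntValued := fun i => ⟨_, map_mem_intValued (F i)⟩ with hG
    refine ⟨h ::ₘ Tᶜ.val.map G, by simp, ?_, ?_⟩
    · intro x hx
      rw [Multiset.mem_cons] at hx
      rcases hx with rfl | hx
      · refine ⟨not_isUnit_of_coe_eq _ hirr T ⟨i₀, hi₀ T hT⟩ _ h rfl, fun u v huv => ?_⟩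
        obtain ⟨a, s, hag, has⟩ := hpart T (fun j : Bool => ((if j then u else v : IntValued) : ℚ[X]))
          (fun j => SetLike.coe_mem _) (by
            rw [Fintype.prod_bool]
            exact (congrArg Subtype.val huv).symm)
        have hfull : T.filter (fun i => a i = a i₀) = T := by
          rw [Finset.filter_eq_self]
          by_contra! hcon
          obtain ⟨i, hi, hne⟩ := hcon
          refine hmin i hi (hmono _ _ (fun k hk => ?_) ((hgood _).1 hag))
          rw [Finset.mem_filter] at hk
          exact Finset.mem_erase.2 ⟨by rintro rfl; exact hne hk.2, hk.1⟩
        have hunit : ∀ j, j ≠ a i₀ → IsUnit (if j then u else v : IntValued) := by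
          intro j hj
          refine isUnit_of_coe_eq_C _ _ (s j).isUnit ?_
          rw [has j, if_neg hj, mul_one, Finset.filter_eq_empty_iff.2, Finset.prod_empty, mul_one]
          intro i hi hij
          rw [← hfull, Finset.mem_filter] at hi
          exact hj (hij.symm.trans hi.2)
        cases hai : a i₀
        · exact Or.inl (by simpa using hunit true (by simp [hai]))
        · exact Or.inr (by simpa using hunit false (by simp [hai]))
      · rw [Multiset.mem_map] at hx
        obtain ⟨i, hi, rfl⟩ := hx
        have hiT : i ∉ T := by simpa using hi
        have key : ∀ u v : IntValued, G i = u * v → IsUnit (u : ℚ[X]) → IsUnit u := by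
          intro u v huv hu
          obtain ⟨c, hc, hcu⟩ := Polynomial.isUnit_iff.1 hu
          obtain ⟨m, hm⟩ := u.2 0
          rw [← hcu, eval_C] at hm
          have huv' : (F i).map (Int.castRingHom ℚ) = (u : ℚ[X]) * v := congrArg Subtype.val huv
          have hv : C c⁻¹ * ∏ i ∈ {i}, (F i).map (Int.castRingHom ℚ) = v := by
            rw [Finset.prod_singleton, huv', ← hcu, ← mul_assoc, ← C_mul,
              inv_mul_cancel₀ hc.ne_zero, C_1, one_mul]
          rcases exists_int_eq_or_of_mem_intValued F hp hd {i} c⁻¹ (hv ▸ v.2) with ⟨k, hk⟩ | ⟨-, hk⟩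
          · have hmk : (m : ℚ) * k = 1 := by rw [← hm, ← hk, mul_inv_cancel₀ hc.ne_zero]
            refine isUnit_of_coe_eq_C u m (IsUnit.of_mul_eq_one k (by exact_mod_cast hmk)) ?_
            rw [← hcu, hm]
          · have := hi₀' _ hk
            rw [Finset.mem_singleton] at this
            exact absurd (this ▸ hi₀ T hT) hiT
        refine ⟨not_isUnit_of_coe_eq _ hirr {i} ⟨i, by simp⟩ 1 _ (by simp [hG]), fun u v huv => ?_⟩
        rcases (hirr i).isUnit_or_isUnit (congrArg Subtype.val huv) with hu | hu
        · exact Or.inl (key u v huv hu)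
        · exact Or.inr (key v u (huv.trans (mul_comm _ _)) hu)
    · rw [Multiset.prod_cons]
      change h * ∏ i ∈ Tᶜ, G i = f
      apply Subtype.ext
      rw [Subring.coe_mul, coe_prod_intValued]
      simp only [hh, hG, hf]
      rw [mul_assoc, Finset.prod_mul_prod_compl]

lemma exists_minimal_card_compl_iff {B K : Type*} [Fintype B] [DecidableEq B] [DecidableEq K]
    [Nonempty K] (b : B → K) (hb : Function.Surjective b) (good : Finset (Option B) → Prop)
    (hgood : ∀ T, good T ↔ none ∈ T ∧ ∀ x y, b x ≠ b y → some x ∈ T ∨ some y ∈ T) (n : ℕ) :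
    (∃ T, good T ∧ (∀ i ∈ T, ¬ good (T.erase i)) ∧ n = Tᶜ.card + 1) ↔
      ∃ k, n = (Finset.univ.filter fun x => b x = k).card + 1 := by
  constructor
  · rintro ⟨T, hT, hmin, rfl⟩
    rw [hgood] at hT
    obtain ⟨x, hx⟩ : ∃ x, some x ∉ T := by
      by_contra! hall
      obtain ⟨x, -⟩ := hb (Classical.arbitrary K)
      refine hmin (some x) (hall x) ((hgood _).2 ⟨by simp [hT.1], fun u v huv => ?_⟩)
      by_cases hux : u = x
      · exact Or.inr (by simp [hall, ← hux, show v ≠ u from fun h => huv (h ▸ rfl)])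
      · exact Or.inl (by simp [hall, hux])
    have hiff : ∀ y, some y ∉ T ↔ b y = b x := by
      intro y
      refine ⟨fun hy => ?_, fun hy hyT => ?_⟩
      · by_contra hne
        exact (hT.2 y x hne).elim hy hx
      · refine hmin _ hyT ((hgood _).2 ⟨by simp [hT.1], fun u v huv => ?_⟩)
        have hcase : ∀ w, b w ≠ b x → some w ∈ T.erase (some y) := fun w hw =>
          Finset.mem_erase.2 ⟨fun h => hw (Option.some_injective _ h ▸ hy),
            (hT.2 w x hw).resolve_right hx⟩
        by_cases hu : b u = b x
        · exact Or.inr (hcase v fun hv => huv (hu.trans hv.symm))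
        · exact Or.inl (hcase u hu)
    refine ⟨b x, ?_⟩
    have : Tᶜ = (Finset.univ.filter fun y => b y = b x).map Function.Embedding.some := by
      ext i
      cases i with
      | none => simp [hT.1]
      | some y => simp [hiff]
    rw [this, Finset.card_map]
  · rintro ⟨k, rfl⟩
    refine ⟨((Finset.univ.filter fun y => b y = k).map Function.Embedding.some)ᶜ, ?_, ?_, ?_⟩
    · refine (hgood _).2 ⟨by simp, fun x y hxy => ?_⟩
      by_cases hx : b x = k
      · exact Or.inr (by simpa using fun hy : b y = k => hxy (hx.trans hy.symm))
      · exact Or.inl (by simpa using hx)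
    · intro i hi hgi
      rw [hgood] at hgi
      cases i with
      | none => simp at hgi
      | some y =>
        have hy : b y ≠ k := by simpa using hi
        obtain ⟨x, hx⟩ := hb k
        have := hgi.2 x y (fun h => hy (h ▸ hx))
        simp [hx] at this
    · rw [compl_compl, Finset.card_map]

lemma exists_lengths_iff_fiber {B K : Type*} [Fintype B] [DecidableEq B] [DecidableEq K]
    [Nonempty K] (b : B → K) (hb : Function.Surjective b) :
    ∃ f : IntValued, ∀ n : ℕ,
      (∃ l : Multiset IntValued, Multiset.card l = n ∧ (∀ g ∈ l, Irreducible g) ∧ l.prod = f)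
        ↔ ∃ k, n = (Finset.univ.filter fun x => b x = k).card + 1 := by
  classical
  obtain ⟨p, hple, hp⟩ := Nat.exists_infinite_primes (Fintype.card (B × B) + 1)
  set e : B → B → ℕ := fun x y => Fintype.equivFin (B × B) (x, y) + 1 with he
  have he_inj : ∀ {x y x' y'}, e x y = e x' y' → x = x' ∧ y = y' := by
    intro x y x' y' h
    have := (Fintype.equivFin (B × B)).injective (Fin.ext (Nat.succ_injective h))
    exact Prod.ext_iff.1 this
  have he_lt : ∀ x y, e x y < p := fun x y => by
    have := (Fintype.equivFin (B × B) (x, y)).isLt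
    simp only [he]
    omega
  have he_pos : ∀ x y, 0 ≠ e x y := fun x y => by simp only [he]; omega
  set Z : Option B → Finset ℕ := fun i => i.elim
    ((Finset.range p).filter fun c => ∀ x y, b x ≠ b y → c ≠ e x y)
    (fun x => (Finset.range p).filter fun c =>
      ∃ y, (y = x ∨ b x ≠ b y) ∧ (c = e x y ∨ c = e y x)) with hZ
  have hZn : ∀ c, c ∈ Z none ↔ c < p ∧ ∀ x y, b x ≠ b y → c ≠ e x y := fun c => by simp [hZ]
  have hZs : ∀ x c, c ∈ Z (some x) ↔
      c < p ∧ ∃ y, (y = x ∨ b x ≠ b y) ∧ (c = e x y ∨ c = e y x) := fun x c => by simp [hZ]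
  have h0 : ∀ i, 0 ∈ Z i ↔ i = none := by
    intro i
    cases i with
    | none => simp [hZn, hp.pos, he_pos]
    | some x => simp [hZs, he_pos]
  obtain ⟨F, hF, hgood, hd⟩ := exists_irreducible_family p hp Z
    (fun i c hc => by
      cases i with
      | none => exact ((hZn c).1 hc).1
      | some x => exact ((hZs x c).1 hc).1)
    (fun i => by
      cases i with
      | none => exact ⟨0, (h0 none).2 rfl⟩
      | some x => exact ⟨e x x, (hZs x _).2 ⟨he_lt x x, x, Or.inl rfl, Or.inl rfl⟩⟩)
    none h0
  have hiff : ∀ T : Finset (Option B), (∀ c < p, ∃ i ∈ T, c ∈ Z i) ↔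
      none ∈ T ∧ ∀ x y, b x ≠ b y → some x ∈ T ∨ some y ∈ T := by
    intro T
    constructor
    · intro h
      refine ⟨?_, fun x y hxy => ?_⟩
      · obtain ⟨i, hi, hi0⟩ := h 0 hp.pos
        rwa [← (h0 i).1 hi0]
      · obtain ⟨i, hi, hic⟩ := h _ (he_lt x y)
        cases i with
        | none => exact absurd rfl (((hZn _).1 hic).2 x y hxy)
        | some z =>
          obtain ⟨-, w, -, hw | hw⟩ := (hZs _ _).1 hic
          · exact Or.inl ((he_inj hw).1 ▸ hi)
          · exact Or.inr ((he_inj hw).2 ▸ hi)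
    · rintro ⟨hn, h⟩ c hc
      by_cases hex : ∀ x y, b x ≠ b y → c ≠ e x y
      · exact ⟨none, hn, (hZn c).2 ⟨hc, hex⟩⟩
      · push Not at hex
        obtain ⟨x, y, hxy, hce⟩ := hex
        rcases h x y hxy with hx | hy
        · exact ⟨_, hx, (hZs x c).2 ⟨hc, y, Or.inr hxy, Or.inl hce⟩⟩
        · exact ⟨_, hy, (hZs y c).2 ⟨hc, x, Or.inr hxy.symm, Or.inr hce⟩⟩
  obtain ⟨f, hf⟩ := exists_lengths_iff F hF hp hd _ (fun T => (hgood T).trans (hiff T))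
    (by simp) none (fun T hT => hT.1)
  exact ⟨f, fun n => (hf n).trans (exists_minimal_card_compl_iff b hb _ (fun _ => Iff.rfl) n)⟩

/-- For every nonempty finite set `S ⊆ ℕ` with all elements `≥ 2`, there is an
integer-valued polynomial `f` whose set of lengths is exactly `S`. -/
theorem sets_of_lengths_realizable (S : Finset ℕ) (hS : S.Nonempty) (h2 : ∀ n ∈ S, 2 ≤ n) :
    ∃ f : IntValued, ∀ n : ℕ,
      (∃ l : Multiset IntValued, Multiset.card l = n ∧ (∀ g ∈ l, Irreducible g) ∧ l.prod = f)
        ↔ n ∈ S := by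
  classical
  have : Nonempty S := hS.to_subtype
  obtain ⟨f, hf⟩ := exists_lengths_iff_fiber (B := Σ k : S, Fin ((k : ℕ) - 1)) (K := S) Sigma.fst
    (fun k => ⟨⟨k, ⟨0, by have := h2 k k.2; omega⟩⟩, rfl⟩)
  refine ⟨f, fun n => (hf n).trans ?_⟩
  have hcard : ∀ k : S, (Finset.univ.filter fun x : Σ k : S, Fin ((k : ℕ) - 1) => x.1 = k).card + 1
      = k := by
    intro k
    have hmap : (Finset.univ.filter fun x : Σ k : S, Fin ((k : ℕ) - 1) => x.1 = k) =
        Finset.univ.map (Function.Embedding.sigmaMk k) := by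
      ext ⟨k', i⟩
      simp only [Finset.mem_filter, Finset.mem_univ, true_and, Finset.mem_map,
        Function.Embedding.sigmaMk_apply]
      exact ⟨by rintro rfl; exact ⟨i, rfl⟩, fun ⟨_, h⟩ => (congrArg Sigma.fst h).symm⟩
    rw [hmap, Finset.card_map, Finset.card_univ, Fintype.card_fin]
    have := h2 k k.2
    omega
  simp only [hcard]
  exact ⟨fun ⟨k, hk⟩ => hk ▸ k.2, fun hn => ⟨⟨n, hn⟩, rfl⟩⟩
end

section
/- Given natural numbers 1 ≤ m₁ ≤ m₂ ≤ … ≤ mₙ, there exists a polynomial H ∈ Int(ℤ) that has exactly n essentially different factorizations into irreducibles in Int(ℤ), the lengths of these factorizations being m₁+1, m₂+1, …, mₙ+1. Precisely: there exist n multisets M₁, …, Mₙ of irreducible elements of Int(ℤ), pairwise distinct as multisets of associate classes, with |Mᵢ| = mᵢ + 1 and with the product of the elements of each Mᵢ equal to H, such that every multiset of irreducible elements of Int(ℤ) whose product is H agrees, up to associates, with one of M₁, …, Mₙ. -/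
open Polynomial

lemma exists_monic_irreducible_eval_eq {p : ℕ} [Fact p.Prime] (hp2 : p ≠ 2)
    (φ : ZMod p → ZMod p) (a : ℤ) (ha : Odd a) (hφ : (a : ZMod p) = φ 1) {N : ℕ} (hN : p ≤ N) :
    ∃ f : ℤ[X], f.Monic ∧ f.natDegree = N ∧ Irreducible f ∧ f.eval 1 = a ∧
      ∀ x : ℤ, ((f.eval x : ℤ) : ZMod p) = φ x := by
  have hp : p.Prime := Fact.out
  have hp3 : 3 ≤ p := by have := hp.two_le; omega
  have h2 : (2 : ZMod p) ≠ 0 := by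
    intro h
    have : ((2 : ℕ) : ZMod p) = 0 := by exact_mod_cast h
    rw [ZMod.natCast_eq_zero_iff] at this
    exact absurd (Nat.le_of_dvd (by norm_num) this) (by omega)
  obtain ⟨s, rfl⟩ := ha
  obtain ⟨q, hqd, hq⟩ : ∃ q : (ZMod p)[X], q.degree < p ∧ ∀ x, q.eval x = (φ x - x ^ N) / 2 := by
    refine ⟨Lagrange.interpolate Finset.univ id (fun x => (φ x - x ^ N) / 2), ?_, fun x => ?_⟩
    · simpa [ZMod.card] using Lagrange.degree_interpolate_lt (s := (Finset.univ : Finset (ZMod p)))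
        (v := id) (fun x => (φ x - x ^ N) / 2) Function.injective_id.injOn
    · exact Lagrange.eval_interpolate_at_node (fun x => (φ x - x ^ N) / 2)
        Function.injective_id.injOn (Finset.mem_univ x)
  obtain ⟨Q, hQ, hQd⟩ : ∃ Q : ℤ[X], Q.map (Int.castRingHom (ZMod p)) = q ∧ Q.degree = q.degree :=
    exists_degree_eq_of_mem_lifts ((mem_lifts q).2 (map_surjective _ ZMod.intCast_surjective q))
  have hQe (x : ℤ) : ((Q.eval x : ℤ) : ZMod p) = (φ x - x ^ N) / 2 := by
    rw [← hq, ← hQ, eval_intCast_map]; simp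
  have he : ((s - Q.eval 1 : ℤ) : ZMod p) = 0 := by
    have := hQe 1
    push_cast at this hφ ⊢
    rw [this, ← hφ]
    field_simp
    ring
  obtain ⟨h, hhd, hh0, hh1, hhe⟩ : ∃ h : ℤ[X], h.degree < N ∧ ¬ (2 : ℤ) ∣ h.coeff 0 ∧
      h.eval 1 = s ∧ ∀ x : ℤ, ((h.eval x : ℤ) : ZMod p) = (φ x - x ^ N) / 2 := by
    have hC (e : ℤ) : (C e).degree < (p : WithBot ℕ) :=
      degree_C_le.trans_lt (by exact_mod_cast hp.pos)
    have hpN : (p : WithBot ℕ) ≤ N := by exact_mod_cast hN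
    have hd : (Q + C (s - Q.eval 1)).degree < (p : WithBot ℕ) :=
      (degree_add_le _ _).trans_lt (max_lt (hQd ▸ hqd) (hC _))
    by_cases hpar : (2 : ℤ) ∣ (Q + C (s - Q.eval 1)).coeff 0
    · refine ⟨Q + C (s - Q.eval 1) + C (p : ℤ) * (X - C 1), ?_, ?_, by simp, fun x => ?_⟩
      · refine ((degree_add_le _ _).trans_lt (max_lt hd ?_)).trans_le hpN
        rw [degree_C_mul (by exact_mod_cast hp.ne_zero), degree_X_sub_C]
        exact_mod_cast hp.one_lt
      · rw [coeff_add]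
        have : ¬ (2 : ℤ) ∣ p := by
          have := hp.eq_two_or_odd
          omega
        intro h
        rw [Int.dvd_add_right hpar] at h
        simp at h
        exact this h
      · rw [← hQe]
        simp only [eval_add, eval_C, eval_mul, Int.cast_add, he]
        simp
    · refine ⟨Q + C (s - Q.eval 1), hd.trans_le hpN, hpar, by simp, fun x => ?_⟩
      rw [← hQe]
      simp only [eval_add, eval_C, Int.cast_add, he, add_zero]
  have hlt : (C 2 * h).degree < (N : WithBot ℕ) := by
    rwa [degree_C_mul two_ne_zero]
  have hmon : (X ^ N + C 2 * h).Monic := monic_X_pow_add hlt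
  have hdeg : (X ^ N + C 2 * h).degree = (N : WithBot ℕ) := by
    rw [degree_add_eq_left_of_degree_lt (by simpa using hlt), degree_X_pow]
  have hN0 : N ≠ 0 := by omega
  refine ⟨X ^ N + C 2 * h, hmon, natDegree_eq_of_degree_eq_some hdeg, ?_, ?_, fun x => ?_⟩
  · refine irreducible_of_eisenstein_criterion (P := Ideal.span {2})
      ((Ideal.span_singleton_prime two_ne_zero).2 Int.prime_two) ?_ ?_ ?_ ?_ hmon.isPrimitive
    · rw [hmon.leadingCoeff, Ideal.mem_span_singleton]
      norm_num
    · intro n hn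
      rw [hdeg] at hn
      have : n ≠ N := by rintro rfl; exact lt_irrefl _ hn
      rw [Ideal.mem_span_singleton, coeff_add, coeff_X_pow, if_neg this, coeff_C_mul, zero_add]
      exact dvd_mul_right _ _
    · rw [hdeg]
      exact_mod_cast Nat.pos_of_ne_zero hN0
    · rw [Ideal.span_singleton_pow, Ideal.mem_span_singleton, coeff_add, coeff_X_pow,
        if_neg hN0.symm, coeff_C_mul, zero_add, pow_two]
      rwa [mul_dvd_mul_iff_left two_ne_zero]
  · simp [hh1]; ring
  · simp only [eval_add, eval_pow, eval_X, eval_mul, eval_C, Int.cast_add, Int.cast_mul, hhe]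
    push_cast
    field_simp
    ring

namespace IntValued

lemma exists_eval_one (f : IntValued) : ∃ z : ℤ, (f : ℚ[X]).eval 1 = z := by
  simpa using f.2 1

lemma not_isUnit_of_prime_dvd {f : IntValued} {q : ℚ[X]} (hq : Prime q) (h : q ∣ (f : ℚ[X])) :
    ¬ IsUnit f := fun hf =>
  hq.not_isUnit (isUnit_of_dvd_unit h (hf.map IntValued.subtype))

lemma isUnit_of_eval_one {f : IntValued} (hf : IsUnit (f : ℚ[X]))
    (h1 : IsUnit ((f : ℚ[X]).eval 1)) (h2 : ∃ z : ℤ, ((f : ℚ[X]).eval 1)⁻¹ = z) : IsUnit f := by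
  obtain ⟨r, -, hr⟩ := isUnit_iff.1 hf
  obtain ⟨z, hz⟩ := h2
  rw [← hr, eval_C] at h1 hz
  refine IsUnit.of_mul_eq_one (z : IntValued) (Subtype.ext ?_)
  have : ((z : IntValued) : ℚ[X]) = C (z : ℚ) := by simp
  rw [Subring.coe_mul, this, ← hz, ← hr, ← C_mul, mul_inv_cancel₀ h1.ne_zero]
  simp

lemma isUnit_left_of_mul_eval_one {f g : IntValued} (hf : IsUnit (f : ℚ[X]))
    (h1 : (f : ℚ[X]).eval 1 * (g : ℚ[X]).eval 1 = 1) : IsUnit f :=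
  isUnit_of_eval_one hf (IsUnit.of_mul_eq_one _ h1) (by
    rw [inv_eq_of_mul_eq_one_right h1]
    exact exists_eval_one g)

lemma irreducible_of_prime {f : IntValued} (hf : Prime (f : ℚ[X]))
    (h1 : (f : ℚ[X]).eval 1 = 1) : Irreducible f := by
  refine ⟨not_isUnit_of_prime_dvd hf dvd_rfl, fun u v huv => ?_⟩
  have hQ : (f : ℚ[X]) = u * v := by rw [huv]; rfl
  rw [hQ, eval_mul] at h1
  refine (hf.irreducible.isUnit_or_isUnit hQ).imp (fun h => ?_) (fun h => ?_)
  · exact isUnit_left_of_mul_eval_one h h1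
  · exact isUnit_left_of_mul_eval_one h (by rwa [mul_comm])

lemma dvd_coe_of_natCast_mul_eq {p : ℕ} (hp : p ≠ 0) {c z h : IntValued}
    (e : (p : IntValued) * h = c * z) : (c : ℚ[X]) ∣ h := by
  have e' := congrArg (Subtype.val) e
  simp only [Subring.coe_mul, SubringClass.coe_natCast] at e'
  have hu : IsUnit (p : ℚ[X]) := by
    rw [← C_eq_natCast]
    exact isUnit_C.2 (isUnit_iff_ne_zero.2 (by exact_mod_cast hp))
  rw [← hu.dvd_mul_left, e']
  exact dvd_mul_right _ _

section Factors

variable {I : Type*} [DecidableEq I] {p : ℕ} {c : IntValued} {F : I → IntValued}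

lemma exists_subset_of_mul_eq (hc : Prime (c : ℚ[X]))
    (hc1 : (c : ℚ[X]).eval 1 = p) (hF : ∀ a, Prime (F a : ℚ[X]))
    (hF1 : ∀ a, (F a : ℚ[X]).eval 1 = 1) {u v : IntValued} {S : Finset I}
    (h : (p : IntValued) * (u * v) = c * ∏ a ∈ S, F a) (hcu : (c : ℚ[X]) ∣ u) :
    ∃ T ⊆ S, ∃ ε : IntValuedˣ, v = ε * ∏ a ∈ T, F a ∧
      (p : IntValued) * u = ↑ε⁻¹ * (c * ∏ a ∈ S \ T, F a) := by
  have hcoe (T : Finset I) : ((∏ a ∈ T, F a : IntValued) : ℚ[X]) = ∏ a ∈ T, (F a : ℚ[X]) :=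
    map_prod IntValued.subtype _ _
  have hprod1 (T : Finset I) : (∏ a ∈ T, (F a : ℚ[X])).eval 1 = 1 := by
    rw [eval_prod]
    exact Finset.prod_eq_one fun a _ => hF1 a
  obtain ⟨w, hw⟩ := hcu
  have h' := congrArg (Subtype.val) h
  simp only [Subring.coe_mul, SubringClass.coe_natCast, hcoe] at h'
  have h'' : ((p : ℚ[X]) * w) * v = 1 * ∏ a ∈ S, (F a : ℚ[X]) := by
    apply mul_left_cancel₀ hc.ne_zero
    rw [one_mul, ← h', hw]
    ring
  obtain ⟨t, T, b, d, htT, hdisj, hbd, hb, hd⟩ := mul_eq_mul_prime_prod (fun a _ => hF a) h''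
  have htS : S \ T = t := by
    rw [← htT, Finset.union_sdiff_right, Finset.sdiff_eq_self_of_disjoint hdisj]
  have hv1 : (v : ℚ[X]).eval 1 = d.eval 1 := by rw [hd, eval_mul, hprod1, mul_one]
  have hu1 : (u : ℚ[X]).eval 1 = b.eval 1 := by
    have := congrArg (eval 1) hb
    rw [eval_mul, eval_mul, hprod1, mul_one, eval_natCast] at this
    rw [← this, hw, eval_mul, hc1]
  have hbd1 : b.eval 1 * d.eval 1 = 1 := by rw [← eval_mul, ← hbd, eval_one]
  obtain ⟨r, -, rfl⟩ := isUnit_iff.1 (IsUnit.of_mul_eq_one_right b hbd.symm)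
  obtain ⟨s, -, rfl⟩ := isUnit_iff.1 (IsUnit.of_mul_eq_one (C r) hbd.symm)
  rw [eval_C] at hv1 hu1 hbd1
  obtain ⟨y, hy⟩ := exists_eval_one u
  obtain ⟨z, hz⟩ := exists_eval_one v
  rw [hv1] at hz
  rw [hu1] at hy
  subst hy hz
  rw [eval_C] at hbd1
  have hyz : y * z = 1 := by exact_mod_cast hbd1
  let ε : IntValuedˣ := ⟨z, y, by rw [mul_comm]; exact_mod_cast congrArg (Int.cast) hyz,
    by exact_mod_cast congrArg (Int.cast) hyz⟩
  refine ⟨T, htT ▸ Finset.subset_union_right, ε, Subtype.ext ?_, Subtype.ext ?_⟩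
  · rw [Subring.coe_mul, hcoe, hd]
    simp [ε]
  · rw [htS, Subring.coe_mul, Subring.coe_mul, Subring.coe_mul, hcoe, hw,
      show ((↑ε⁻¹ : IntValued) : ℚ[X]) = C (y : ℚ) by simp [ε], SubringClass.coe_natCast,
      mul_left_comm, hb]
    ring

lemma exists_subset_of_mul_multiset_prod_eq (hc : Prime (c : ℚ[X]))
    (hc1 : (c : ℚ[X]).eval 1 = p) (hF : ∀ a, Prime (F a : ℚ[X]))
    (hF1 : ∀ a, (F a : ℚ[X]).eval 1 = 1) (L : Multiset IntValued) (hL : ∀ g ∈ L, Irreducible g)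
    (u : IntValued) (S : Finset I) (h : (p : IntValued) * (u * L.prod) = c * ∏ a ∈ S, F a)
    (hcu : (c : ℚ[X]) ∣ u) :
    ∃ T ⊆ S, ∃ ε : IntValuedˣ, L.map Associates.mk = (T.val.map F).map Associates.mk ∧
      (p : IntValued) * u = ε * (c * ∏ a ∈ S \ T, F a) := by
  induction L using Multiset.induction generalizing u S with
  | empty => exact ⟨∅, by simp, 1, by simp, by simpa using h⟩
  | cons g L ih =>
    have hg : Irreducible g := hL g (Multiset.mem_cons_self _ _)
    obtain ⟨R, hRS, ε, hgR, hu⟩ := exists_subset_of_mul_eq hc hc1 hF hF1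
      (u := u * L.prod) (v := g) (S := S) (by rw [← h, Multiset.prod_cons]; ring)
      (by rw [Subring.coe_mul]; exact hcu.mul_right _)
    obtain ⟨a, rfl⟩ : ∃ a, R = {a} := by
      obtain rfl | ⟨a, ha⟩ := R.eq_empty_or_nonempty
      · exact absurd (by rw [hgR]; simp) hg.not_isUnit
      refine ⟨a, ?_⟩
      rw [← Finset.insert_erase ha, Finset.prod_insert (Finset.notMem_erase _ _)] at hgR
      have hX : IsUnit (ε * ∏ b ∈ R.erase a, F b) :=
        (hg.isUnit_or_isUnit (by rw [hgR]; ring : g = F a * (ε * ∏ b ∈ R.erase a, F b))).resolve_left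
          (irreducible_of_prime (hF a) (hF1 a)).not_isUnit
      have hR : R.erase a = ∅ := by
        by_contra hne
        obtain ⟨b, hb⟩ := Finset.nonempty_iff_ne_empty.2 hne
        refine (irreducible_of_prime (hF b) (hF1 b)).not_isUnit (isUnit_of_dvd_unit ?_ hX)
        exact (Finset.dvd_prod_of_mem F hb).mul_left _
      rw [← Finset.insert_erase ha, hR, insert_empty_eq]
    rw [Finset.singleton_subset_iff] at hRS
    obtain ⟨T, hTS, δ, hLT, hδ⟩ := ih (fun x hx => hL x (Multiset.mem_cons_of_mem hx)) (ε * u)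
      (S \ {a}) (by
        rw [mul_assoc, mul_left_comm, hu, Units.mul_inv_cancel_left])
      (by rw [Subring.coe_mul]; exact hcu.mul_left _)
    have haT : a ∉ T := fun h => by simpa using hTS h
    refine ⟨insert a T, Finset.insert_subset hRS (hTS.trans Finset.sdiff_subset), ε⁻¹ * δ, ?_, ?_⟩
    · rw [Finset.insert_val_of_notMem haT, Multiset.map_cons, Multiset.map_cons, Multiset.map_cons,
        hLT]
      congr 1
      rw [hgR, Finset.prod_singleton, Associates.mk_eq_mk_iff_associated]
      exact (associated_isUnit_mul_left_iff ε.isUnit).2 (Associated.refl _)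
    · rw [mul_left_comm] at hδ
      rw [Units.val_mul, mul_assoc, Units.eq_inv_mul_iff_mul_eq, hδ, sdiff_sdiff_left,
        Finset.sup_eq_union, ← Finset.insert_eq]

theorem exists_factorizations_of_covering [Fintype I] {n : ℕ} (hn : 0 < n) {m : Fin n → ℕ}
    (h1 : ∀ i, 1 ≤ m i) (block : I → Fin n)
    (hcard : ∀ k, (Finset.univ.filter (block · = k)).card = m k)
    (hp : p ≠ 0) (hc : Prime (c : ℚ[X]))
    (hc1 : (c : ℚ[X]).eval 1 = p) (hF : ∀ a, Prime (F a : ℚ[X]))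
    (hF1 : ∀ a, (F a : ℚ[X]).eval 1 = 1)
    (hcov : ∀ S : Finset I, (p : IntValued) ∣ c * ∏ a ∈ S, F a ↔
      ∀ a b, block a ≠ block b → a ∈ S ∨ b ∈ S)
    (hinj : ∀ a b, Associated (F a) (F b) → a = b) (hcF : ∀ a, ¬ (c : ℚ[X]) ∣ F a) :
    ∃ H : IntValued, ∃ M : Fin n → Multiset IntValued,
      (∀ i, ∀ g ∈ M i, Irreducible g) ∧
      (∀ i, Multiset.card (M i) = m i + 1) ∧
      (∀ i, (M i).prod = H) ∧
      (∀ i j, i ≠ j → (M i).map Associates.mk ≠ (M j).map Associates.mk) ∧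
      (∀ L : Multiset IntValued, (∀ g ∈ L, Irreducible g) → L.prod = H →
        ∃ i, L.map Associates.mk = (M i).map Associates.mk) := by
  set B : Fin n → Finset I := fun k => Finset.univ.filter (block · = k) with hB
  have hmem (k a) : a ∈ B k ↔ block a = k := by simp [hB]
  have hp0 : (p : IntValued) ≠ 0 := fun h => by
    have := congrArg (Subtype.val) h
    simp [hp] at this
  have hex (k) : (p : IntValued) ∣ c * ∏ a ∈ (B k)ᶜ, F a := by
    rw [hcov]
    intro a b hab
    simp only [Finset.mem_compl, hmem]
    by_contra! h
    exact hab (h.1.trans h.2.symm)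
  choose h hh using hex
  have hch (k) : (c : ℚ[X]) ∣ h k := dvd_coe_of_natCast_mul_eq hp (hh k).symm
  have hnu (k) : ¬ IsUnit (h k) := not_isUnit_of_prime_dvd hc (hch k)
  have hFnu (a) : ¬ IsUnit (F a) := (irreducible_of_prime (hF a) (hF1 a)).not_isUnit
  have hirr (k) : Irreducible (h k) := by
    refine ⟨hnu k, ?_⟩
    have key (u v : IntValued) (huv : h k = u * v) (hcu : (c : ℚ[X]) ∣ u) : IsUnit v := by
      obtain ⟨T, hT, ε, hv, hu⟩ := exists_subset_of_mul_eq hc hc1 hF hF1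
        (u := u) (v := v) (S := (B k)ᶜ) (by rw [← huv, hh]) hcu
      obtain rfl | ⟨a, ha⟩ := T.eq_empty_or_nonempty
      · rw [hv]; simp
      exfalso
      obtain ⟨b, hb⟩ : (B k).Nonempty := by
        rw [← Finset.card_pos, hcard]
        exact h1 k
      have hak : block a ≠ k := by simpa [hmem] using hT ha
      rw [hmem] at hb
      have hd : (p : IntValued) ∣ c * ∏ a ∈ (B k)ᶜ \ T, F a :=
        ⟨ε * u, by rw [mul_left_comm, hu, Units.mul_inv_cancel_left]⟩
      rcases (hcov _).1 hd a b (hb ▸ hak) with h | h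
      · exact (Finset.mem_sdiff.1 h).2 ha
      · have := (Finset.mem_sdiff.1 h).1
        simp [hmem, hb] at this
    intro u v huv
    have : (c : ℚ[X]) ∣ u * v := by
      have := hch k
      rwa [huv] at this
    rcases hc.dvd_or_dvd this with hu | hv
    · exact Or.inr (key u v huv hu)
    · exact Or.inl (key v u (huv.trans (mul_comm _ _)) hv)
  have hprod (k) : (p : IntValued) * (h k * ∏ a ∈ B k, F a) = c * ∏ a, F a := by
    rw [← mul_assoc, ← hh, mul_assoc, mul_comm (∏ a ∈ (B k)ᶜ, F a), Finset.prod_mul_prod_compl]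
  refine ⟨h ⟨0, hn⟩ * ∏ a ∈ B ⟨0, hn⟩, F a, fun k => h k ::ₘ (B k).val.map F, ?_, ?_, ?_, ?_, ?_⟩
  · intro k g hg
    rcases Multiset.mem_cons.1 hg with rfl | hg
    · exact hirr k
    · obtain ⟨a, -, rfl⟩ := Multiset.mem_map.1 hg
      exact irreducible_of_prime (hF a) (hF1 a)
  · intro k
    rw [Multiset.card_cons, Multiset.card_map, Finset.card_val, hcard]
  · intro k
    rw [Multiset.prod_cons]
    apply mul_left_cancel₀ hp0
    rw [hprod]
    exact hprod k
  · intro i j hij heq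
    obtain ⟨a, ha⟩ : (B i).Nonempty := by
      rw [← Finset.card_pos, hcard]
      exact h1 i
    have hm : Associates.mk (F a) ∈ (h j ::ₘ (B j).val.map F).map Associates.mk := by
      rw [← heq]
      exact Multiset.mem_map_of_mem _ (Multiset.mem_cons_of_mem (Multiset.mem_map_of_mem _ ha))
    obtain ⟨g, hg, hgm⟩ := Multiset.mem_map.1 hm
    rw [Associates.mk_eq_mk_iff_associated] at hgm
    rcases Multiset.mem_cons.1 hg with rfl | hg
    · exact hcF a ((hch j).trans (map_dvd IntValued.subtype hgm.dvd))
    · obtain ⟨b, hb, rfl⟩ := Multiset.mem_map.1 hg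
      obtain rfl := hinj _ _ hgm
      exact hij (((hmem _ _).1 ha).symm.trans ((hmem _ _).1 hb))
  · intro L hL hLH
    have hcL : (c : ℚ[X]) ∣ (L.map IntValued.subtype).prod := by
      rw [← map_multiset_prod, hLH]
      exact dvd_coe_of_natCast_mul_eq hp (hprod _)
    obtain ⟨g', hg', hcg⟩ := hc.exists_mem_multiset_dvd hcL
    obtain ⟨g, hg, rfl⟩ := Multiset.mem_map.1 hg'
    obtain ⟨L, rfl⟩ := Multiset.exists_cons_of_mem hg
    obtain ⟨T, -, ε, hLT, hgT⟩ := exists_subset_of_mul_multiset_prod_eq hc hc1 hF hF1 L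
      (fun x hx => hL x (Multiset.mem_cons_of_mem hx)) g Finset.univ
      (by rw [← Multiset.prod_cons, hLH, hprod]) hcg
    have hcovT := (hcov (Finset.univ \ T)).1
      ⟨↑ε⁻¹ * g, by rw [mul_left_comm, hgT, Units.inv_mul_cancel_left]⟩
    obtain ⟨k, hk⟩ : ∃ k, T ⊆ B k := by
      obtain rfl | ⟨a, ha⟩ := T.eq_empty_or_nonempty
      · exact ⟨⟨0, hn⟩, Finset.empty_subset _⟩
      refine ⟨block a, fun b hb => ?_⟩
      rw [hmem]
      by_contra hab
      simpa [ha, hb] using hcovT b a hab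
    have hgk : g = h k * (ε * ∏ a ∈ B k \ T, F a) := by
      apply mul_left_cancel₀ hp0
      rw [hgT, ← mul_assoc (p : IntValued), ← hh, mul_assoc, mul_left_comm (∏ a ∈ (B k)ᶜ, F a),
        mul_left_comm c, ← Finset.prod_union]
      · congr 3
        ext a
        have := @hk a
        simp only [Finset.mem_sdiff, Finset.mem_univ, true_and, Finset.mem_union,
          Finset.mem_compl]
        tauto
      · rw [Finset.disjoint_left]
        intro a ha ha'
        exact Finset.mem_compl.1 ha (Finset.mem_sdiff.1 ha').1
    have hunit := ((hL g (Multiset.mem_cons_self _ _)).isUnit_or_isUnit hgk).resolve_left (hnu k)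
    obtain rfl : T = B k := by
      refine hk.antisymm fun b hb => ?_
      by_contra hbT
      refine hFnu b (isUnit_of_dvd_unit ?_ hunit)
      exact (Finset.dvd_prod_of_mem F (Finset.mem_sdiff.2 ⟨hb, hbT⟩)).mul_left _
    refine ⟨k, ?_⟩
    rw [Multiset.map_cons, Multiset.map_cons, hLT]
    congr 1
    rw [Associates.mk_eq_mk_iff_associated, hgk]
    exact (associated_mul_isUnit_left_iff hunit).2 (Associated.refl _)

end Factors

/-- The inclusion of `ℤ[X]` into the ring of integer-valued polynomials. -/
noncomputable def ofIntPoly : ℤ[X] →+* IntValued :=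
  (mapRingHom (Int.castRingHom ℚ)).codRestrict IntValued fun f c =>
    ⟨f.eval c, by rw [coe_mapRingHom, eval_intCast_map]; simp⟩

lemma coe_ofIntPoly (f : ℤ[X]) : (ofIntPoly f : ℚ[X]) = f.map (Int.castRingHom ℚ) := rfl

lemma natCast_dvd_ofIntPoly {p : ℕ} (hp : p ≠ 0) (f : ℤ[X]) :
    (p : IntValued) ∣ ofIntPoly f ↔ ∀ x : ℤ, ((f.eval x : ℤ) : ZMod p) = 0 := by
  have hp' : (p : ℚ) ≠ 0 := by exact_mod_cast hp
  constructor
  · rintro ⟨g, hg⟩ x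
    obtain ⟨z, hz⟩ := g.2 x
    have := congrArg (fun q : IntValued => (q : ℚ[X]).eval (x : ℚ)) hg
    simp only [Subring.coe_mul, SubringClass.coe_natCast, eval_mul, hz, eval_natCast,
      coe_ofIntPoly] at this
    rw [eval_intCast_map] at this
    have h : f.eval x = p * z := by
      simp only [eq_intCast] at this
      exact_mod_cast this
    rw [h]
    simp
  · intro h
    refine ⟨⟨C (p : ℚ)⁻¹ * ofIntPoly f, fun x => ?_⟩, Subtype.ext ?_⟩
    · obtain ⟨z, hz⟩ := (ZMod.intCast_zmod_eq_zero_iff_dvd _ _).1 (h x)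
      refine ⟨z, ?_⟩
      rw [eval_mul, eval_C, coe_ofIntPoly, eval_intCast_map, Int.cast_id, hz]
      simp [hp']
    · rw [Subring.coe_mul, SubringClass.coe_natCast, ← mul_assoc, ← C_eq_natCast, ← C_mul,
        mul_inv_cancel₀ hp', C_1, one_mul]

end IntValued

/-- Given `1 ≤ m₁ ≤ … ≤ mₙ`, there is `H ∈ Int(ℤ)` with exactly `n` essentially
different factorizations into irreducibles, of lengths `m₁ + 1, …, mₙ + 1`. -/
theorem prescribed_factorizations (n : ℕ) (m : Fin n → ℕ)
    (h1 : ∀ i, 1 ≤ m i) (hmono : Monotone m) :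
    ∃ H : IntValued, ∃ M : Fin n → Multiset IntValued,
      (∀ i, ∀ g ∈ M i, Irreducible g) ∧
      (∀ i, Multiset.card (M i) = m i + 1) ∧
      (∀ i, (M i).prod = H) ∧
      (∀ i j, i ≠ j → (M i).map Associates.mk ≠ (M j).map Associates.mk) ∧
      (∀ L : Multiset IntValued, (∀ g ∈ L, Irreducible g) → L.prod = H →
        ∃ i, L.map Associates.mk = (M i).map Associates.mk) := by
  classical
  rcases Nat.eq_zero_or_pos n with rfl | hn
  · refine ⟨0, fun i => i.elim0, fun i => i.elim0, fun i => i.elim0, fun i => i.elim0,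
      fun i => i.elim0, fun L hL h0 => ?_⟩
    exact absurd rfl (hL 0 (Multiset.prod_eq_zero_iff.1 h0)).ne_zero
  let I := Σ k : Fin n, Fin (m k)
  let block : I → Fin n := Sigma.fst
  obtain ⟨p, hpI, hp⟩ := Nat.exists_infinite_primes (Fintype.card (I × I) + 3)
  have : Fact p.Prime := ⟨hp⟩
  have hp2 : p ≠ 2 := by omega
  obtain ⟨e, he, he1⟩ : ∃ e : I × I → ZMod p, Function.Injective e ∧ ∀ x, e x ≠ 1 := by
    have hlt (x : I × I) : (Fintype.equivFin (I × I) x : ℕ) + 2 < p := by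
      have := (Fintype.equivFin (I × I) x).2
      omega
    refine ⟨fun x => ((Fintype.equivFin (I × I) x + 2 : ℕ) : ZMod p), fun x y hxy => ?_,
      fun x hx => ?_⟩
    · rw [ZMod.natCast_eq_natCast_iff', Nat.mod_eq_of_lt (hlt x), Nat.mod_eq_of_lt (hlt y)] at hxy
      exact (Fintype.equivFin (I × I)).injective (Fin.ext (by omega))
    · rw [← Nat.cast_one, ZMod.natCast_eq_natCast_iff', Nat.mod_eq_of_lt (hlt x),
        Nat.mod_eq_of_lt hp.one_lt] at hx
      omega
  obtain ⟨c, hcm, hcd, hci, hc1, hcφ⟩ := exists_monic_irreducible_eval_eq hp2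
    (fun x => if ∃ a b, block a ≠ block b ∧ x = e (a, b) then 1 else 0) p
    (by exact_mod_cast hp.odd_of_ne_two hp2)
    (by simp [(he1 _).symm]) le_rfl
  have hF (a : I) := exists_monic_irreducible_eval_eq hp2
    (fun x => if ∃ b, block a ≠ block b ∧ (x = e (a, b) ∨ x = e (b, a)) then 0 else 1) 1
    odd_one (by simp [(he1 _).symm])
    (show p ≤ p + 1 + Fintype.equivFin I a by omega)
  choose F hFm hFd hFi hF1 hFφ using hF
  have hprime {f : ℤ[X]} (hfm : f.Monic) (hf : Irreducible f) : Prime (IntValued.ofIntPoly f : ℚ[X]) :=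
    ((hfm.irreducible_iff_irreducible_map_fraction_map (K := ℚ)).1 hf).prime
  have heval (f : ℤ[X]) : (IntValued.ofIntPoly f : ℚ[X]).eval 1 = (f.eval 1 : ℤ) := by
    rw [IntValued.coe_ofIntPoly]
    exact_mod_cast eval_intCast_map (Int.castRingHom ℚ) f 1
  have hdeg {f g : ℤ[X]} (h : Associated (IntValued.ofIntPoly f : ℚ[X]) (IntValued.ofIntPoly g)) :
      f.natDegree = g.natDegree := by
    have := natDegree_eq_of_degree_eq (degree_eq_degree_of_associated h)
    rwa [IntValued.coe_ofIntPoly, IntValued.coe_ofIntPoly,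
      natDegree_map_eq_of_injective (RingHom.injective_int (Int.castRingHom ℚ)),
      natDegree_map_eq_of_injective (RingHom.injective_int (Int.castRingHom ℚ))] at this
  refine IntValued.exists_factorizations_of_covering (p := p) (c := IntValued.ofIntPoly c)
    (F := fun a => IntValued.ofIntPoly (F a)) hn h1 block (fun k => ?_) hp.ne_zero (hprime hcm hci)
    (by rw [heval, hc1]; simp) (fun a => hprime (hFm a) (hFi a))
    (fun a => by rw [heval, hF1]; simp) (fun S => ?_) (fun a b hab => ?_) (fun a hca => ?_)
  · rw [← Fintype.card_subtype, Fintype.card_congr (Equiv.sigmaSubtype k), Fintype.card_fin]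
  · rw [← map_prod, ← map_mul, IntValued.natCast_dvd_ofIntPoly hp.ne_zero]
    simp only [eval_mul, eval_prod, Int.cast_mul, Int.cast_prod, hcφ, hFφ, mul_eq_zero,
      Finset.prod_eq_zero_iff, ite_eq_right_iff, ite_eq_left_iff, one_ne_zero,
      imp_false, not_not]
    constructor
    · intro h a b hab
      obtain ⟨x, hx⟩ := ZMod.intCast_surjective (e (a, b))
      rcases h x with h | ⟨d, hd, d', -, h | h⟩
      · exact absurd ⟨a, b, hab, hx⟩ h
      · rw [hx] at h
        have := he h
        simp only [Prod.mk.injEq] at this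
        exact Or.inl (this.1 ▸ hd)
      · rw [hx] at h
        have := he h
        simp only [Prod.mk.injEq] at this
        exact Or.inr (this.2 ▸ hd)
    · intro h x
      by_cases hx : ∃ a b, block a ≠ block b ∧ (x : ZMod p) = e (a, b)
      · right
        obtain ⟨a, b, hab, hx⟩ := hx
        rcases h a b hab with ha | hb
        · exact ⟨a, ha, b, hab, Or.inl hx⟩
        · exact ⟨b, hb, a, hab.symm, Or.inr hx⟩
      · exact Or.inl hx
  · have := hdeg (hab.map IntValued.subtype)
    rw [hFd, hFd] at this
    exact (Fintype.equivFin I).injective (Fin.ext (by omega))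
  · have := hdeg ((hprime hcm hci).irreducible.associated_of_dvd
      (hprime (hFm a) (hFi a)).irreducible hca)
    rw [hcd, hFd] at this
    omega
end

section
/- For every natural number n ≥ 0, there exists a polynomial H ∈ Int(ℤ) that has exactly two essentially different factorizations into irreducibles in Int(ℤ), one of length 2 and one of length n + 2. In particular, the set of lengths of H is {2, n+2}. -/
open Polynomial

/-- The product of `F i` over `T`, as an element of `IntValued`, or `1` if it is not
integer-valued. -/
noncomputable def prodAtom {ι : Type*} (F : ι → ℚ[X]) (T : Finset ι) : IntValued :=
  open Classical in
  if h : ∏ i ∈ T, F i ∈ IntValued then ⟨_, h⟩ else 1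

theorem coe_prodAtom {ι : Type*} {F : ι → ℚ[X]} {T : Finset ι} (h : ∏ i ∈ T, F i ∈ IntValued) :
    (prodAtom F T : ℚ[X]) = ∏ i ∈ T, F i := by
  simp [prodAtom, h]

/-- The factors obtained from `∏ i ∈ T, F i` by grouping the indices in `J` together. -/
noncomputable def groupedFactors {ι : Type*} [DecidableEq ι] (F : ι → ℚ[X]) (J T : Finset ι) :
    Multiset IntValued :=
  prodAtom F J ::ₘ (T \ J).val.map fun i => prodAtom F {i}

theorem isUnit_coe_of_isUnit {a : IntValued} (h : IsUnit a) : IsUnit (a : ℚ[X]) :=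
  h.map IntValued.subtype

theorem isUnit_intCast_unit {R : Type*} [Ring R] (ε : ℤˣ) : IsUnit ((ε : ℤ) : R) :=
  ε.isUnit.map (Int.castRingHom R)

theorem prod_mem_intValued {ι : Type*} {F : ι → ℚ[X]} {z : ι}
    (hval : ∀ i, i ≠ z → F i ∈ IntValued) {T : Finset ι} (hz : z ∉ T) :
    ∏ i ∈ T, F i ∈ IntValued :=
  prod_mem fun i hi => hval i (by rintro rfl; exact hz hi)

theorem eq_empty_of_isUnit_prod {ι : Type*} {F : ι → ℚ[X]} (hF : ∀ i, Prime (F i))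
    {T : Finset ι} (h : IsUnit (∏ i ∈ T, F i)) : T = ∅ := by
  by_contra hne
  obtain ⟨i, hi⟩ := Finset.nonempty_iff_ne_empty.2 hne
  exact (hF i).not_isUnit (isUnit_of_dvd_unit (Finset.dvd_prod_of_mem F hi) h)

theorem eval_zero_prod {ι : Type*} {F : ι → ℚ[X]} (h0 : ∀ i, (F i).eval 0 = 1)
    (T : Finset ι) : (∏ i ∈ T, F i).eval 0 = 1 := by
  rw [eval_prod]
  exact Finset.prod_eq_one fun i _ => h0 i

theorem mk_eq_mk_prodAtom {ι : Type*} {F : ι → ℚ[X]} {a : IntValued} {T : Finset ι} {δ : ℤˣ}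
    (ha : (a : ℚ[X]) = ((δ : ℤ) : ℚ[X]) * ∏ i ∈ T, F i) :
    ∏ i ∈ T, F i ∈ IntValued ∧ Associates.mk a = Associates.mk (prodAtom F T) := by
  have hT : ∏ i ∈ T, F i = ((((δ : ℤ) : IntValued) * a : IntValued) : ℚ[X]) := by
    push_cast
    rw [ha, ← mul_assoc, ← Int.cast_mul]
    simp [← Units.val_mul]
  have hmem : ∏ i ∈ T, F i ∈ IntValued := hT ▸ Subtype.property _
  refine ⟨hmem, ?_⟩
  rw [Associates.mk_eq_mk_iff_associated]
  have : prodAtom F T = ((δ : ℤ) : IntValued) * a := by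
    apply Subtype.ext
    rw [coe_prodAtom hmem, hT]
  rw [this]
  exact (associated_unit_mul_right a _ (isUnit_intCast_unit δ))

theorem exists_eq_mul_prod {ι : Type*} [DecidableEq ι] {F : ι → ℚ[X]} (hF : ∀ i, Prime (F i))
    (h0 : ∀ i, (F i).eval 0 = 1) {a b : IntValued} {T : Finset ι} {ε : ℤˣ}
    (hab : (a : ℚ[X]) * b = ((ε : ℤ) : ℚ[X]) * ∏ i ∈ T, F i) :
    ∃ (t v : Finset ι) (δ γ : ℤˣ), t ∪ v = T ∧ Disjoint t v ∧
      (a : ℚ[X]) = ((δ : ℤ) : ℚ[X]) * ∏ i ∈ t, F i ∧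
      (b : ℚ[X]) = ((γ : ℤ) : ℚ[X]) * ∏ i ∈ v, F i := by
  obtain ⟨t, v, β, γ, htv, hd, hβγ, ha, hb⟩ := mul_eq_mul_prime_prod (fun i _ => hF i) hab
  have hu : IsUnit (β * γ) := hβγ ▸ isUnit_intCast_unit ε
  obtain ⟨x, -, rfl⟩ := isUnit_iff.1 (isUnit_of_mul_isUnit_left hu)
  obtain ⟨y, -, rfl⟩ := isUnit_iff.1 (isUnit_of_mul_isUnit_right hu)
  obtain ⟨m, hm⟩ := a.2 0
  obtain ⟨k, hk⟩ := b.2 0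
  have hx : x = m := by simpa [ha, eval_zero_prod h0] using hm
  have hy : y = k := by simpa [hb, eval_zero_prod h0] using hk
  have hmk : (ε : ℤ) = m * k := by
    have h := congrArg (eval 0) hβγ
    simp only [eval_intCast, eval_mul, eval_C, hx, hy] at h
    exact_mod_cast h
  have hmk' : IsUnit (m * k) := hmk ▸ ε.isUnit
  refine ⟨t, v, (isUnit_of_mul_isUnit_left hmk').unit, (isUnit_of_mul_isUnit_right hmk').unit,
    htv, hd, ?_, ?_⟩
  · simpa [hx] using ha
  · simpa [hy] using hb

theorem eq_of_irreducible {ι : Type*} [DecidableEq ι] {F : ι → ℚ[X]} (hF : ∀ i, Prime (F i))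
    {a : IntValued} (hirr : Irreducible a) {s t : Finset ι} {δ : ℤˣ}
    (ha : (a : ℚ[X]) = ((δ : ℤ) : ℚ[X]) * ∏ i ∈ t, F i) (hst : s ⊆ t) (hs : s ≠ ∅)
    (hs1 : ∏ i ∈ s, F i ∈ IntValued) (hs2 : ∏ i ∈ t \ s, F i ∈ IntValued) : t = s := by
  have h : a = prodAtom F s * (((δ : ℤ) : IntValued) * prodAtom F (t \ s)) := by
    apply Subtype.ext
    push_cast
    rw [ha, coe_prodAtom hs1, coe_prodAtom hs2, ← Finset.prod_sdiff hst]
    ring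
  rcases hirr.isUnit_or_isUnit h with h1 | h1
  · have := isUnit_coe_of_isUnit h1
    rw [coe_prodAtom hs1] at this
    exact absurd (eq_empty_of_isUnit_prod hF this) hs
  · have := isUnit_coe_of_isUnit (isUnit_of_mul_isUnit_right h1)
    rw [coe_prodAtom hs2] at this
    exact (Finset.sdiff_eq_empty_iff_subset.1 (eq_empty_of_isUnit_prod hF this)).antisymm hst

theorem irreducible_prodAtom {ι : Type*} [DecidableEq ι] {F : ι → ℚ[X]} (hF : ∀ i, Prime (F i))
    (h0 : ∀ i, (F i).eval 0 = 1) {z : ι} {J : Finset ι} (hzJ : z ∈ J)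
    (hJ : ∏ i ∈ J, F i ∈ IntValued)
    (hmin : ∀ t ⊆ J, z ∈ t → ∏ i ∈ t, F i ∈ IntValued → t = J) : Irreducible (prodAtom F J) := by
  have key : ∀ {a b : IntValued} {t v : Finset ι} {δ γ : ℤˣ}, t ∪ v = J → Disjoint t v →
      (a : ℚ[X]) = ((δ : ℤ) : ℚ[X]) * ∏ i ∈ t, F i →
      (b : ℚ[X]) = ((γ : ℤ) : ℚ[X]) * ∏ i ∈ v, F i → z ∈ t → IsUnit b := by
    intro a b t v δ γ htv hd ha hb hz
    have hv : v = ∅ := by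
      obtain rfl := hmin t (htv ▸ Finset.subset_union_left) hz (mk_eq_mk_prodAtom ha).1
      exact hd.symm.eq_bot_of_le (htv ▸ Finset.subset_union_right)
    have : b = ((γ : ℤ) : IntValued) := Subtype.ext (by simpa [hv] using hb)
    exact this ▸ isUnit_intCast_unit γ
  refine ⟨fun h => ?_, fun a b hab => ?_⟩
  · have := isUnit_coe_of_isUnit h
    rw [coe_prodAtom hJ] at this
    simp [eq_empty_of_isUnit_prod hF this] at hzJ
  · have hab' : (a : ℚ[X]) * b = (((1 : ℤˣ) : ℤ) : ℚ[X]) * ∏ i ∈ J, F i := by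
      rw [← coe_prodAtom hJ, hab]
      simp
    obtain ⟨t, v, δ, γ, htv, hd, ha, hb⟩ := exists_eq_mul_prod hF h0 hab'
    rcases Finset.mem_union.1 (htv ▸ hzJ) with hz | hz
    · exact Or.inr (key htv hd ha hb hz)
    · exact Or.inl (key (Finset.union_comm v t ▸ htv) hd.symm hb ha hz)

theorem irreducible_prodAtom_singleton {ι : Type*} [DecidableEq ι] {F : ι → ℚ[X]}
    (hF : ∀ i, Prime (F i)) (h0 : ∀ i, (F i).eval 0 = 1) {i : ι} (hi : F i ∈ IntValued) :
    Irreducible (prodAtom F {i}) :=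
  irreducible_prodAtom hF h0 (Finset.mem_singleton_self i) (by simpa using hi)
    fun _ ht hz _ => ht.antisymm (Finset.singleton_subset_iff.2 hz)

theorem exists_eq_singleton {ι : Type*} [DecidableEq ι] {F : ι → ℚ[X]} (hF : ∀ i, Prime (F i))
    {z : ι} (hval : ∀ i, i ≠ z → F i ∈ IntValued)
    {a : IntValued} (hirr : Irreducible a) {t : Finset ι} {δ : ℤˣ} (hz : z ∉ t)
    (ha : (a : ℚ[X]) = ((δ : ℤ) : ℚ[X]) * ∏ i ∈ t, F i) : ∃ j, t = {j} := by
  rcases t.eq_empty_or_nonempty with rfl | ⟨j, hj⟩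
  · have : a = ((δ : ℤ) : IntValued) := Subtype.ext (by simpa using ha)
    exact absurd (this ▸ isUnit_intCast_unit δ) hirr.not_isUnit
  · refine ⟨j, eq_of_irreducible hF hirr ha (Finset.singleton_subset_iff.2 hj) (by simp)
      (prod_mem_intValued hval ?_) (prod_mem_intValued hval ?_)⟩
    · rw [Finset.mem_singleton]; rintro rfl; exact hz hj
    · exact fun h => hz (Finset.mem_sdiff.1 h).1

theorem map_mk_eq_of_prod_eq {ι : Type*} [DecidableEq ι] {F : ι → ℚ[X]} (hF : ∀ i, Prime (F i))
    (h0 : ∀ i, (F i).eval 0 = 1) {z : ι} (hval : ∀ i, i ≠ z → F i ∈ IntValued)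
    (L : Multiset IntValued) (hL : ∀ g ∈ L, Irreducible g) {T : Finset ι} {ε : ℤˣ} (hz : z ∉ T)
    (h : (L.prod : ℚ[X]) = ((ε : ℤ) : ℚ[X]) * ∏ i ∈ T, F i) :
    L.map Associates.mk = T.val.map fun i => Associates.mk (prodAtom F {i}) := by
  induction L using Multiset.induction generalizing T ε with
  | empty =>
    have : IsUnit (∏ i ∈ T, F i) := by
      apply isUnit_of_mul_isUnit_right (x := ((ε : ℤ) : ℚ[X]))
      rw [← h]
      simp
    simp [eq_empty_of_isUnit_prod hF this]
  | cons a L ih =>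
    rw [Multiset.prod_cons, Subring.coe_mul] at h
    obtain ⟨t, v, δ, γ, rfl, hd, ha, hb⟩ := exists_eq_mul_prod hF h0 h
    rw [Finset.mem_union, not_or] at hz
    obtain ⟨j, rfl⟩ := exists_eq_singleton hF hval (hL a (Multiset.mem_cons_self a L)) hz.1 ha
    have hj : j ∉ v := Finset.disjoint_singleton_left.1 hd
    rw [Multiset.map_cons, ih (fun g hg => hL g (Multiset.mem_cons_of_mem hg)) hz.2 hb,
      (mk_eq_mk_prodAtom ha).2, ← Finset.insert_eq, Finset.insert_val_of_notMem hj,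
      Multiset.map_cons]

/-- Every factorization of `∏ i ∈ T, F i` arises by grouping the indices in some `J ∋ z`. -/
theorem exists_map_mk_eq_groupedFactors {ι : Type*} [DecidableEq ι] {F : ι → ℚ[X]}
    (hF : ∀ i, Prime (F i)) (h0 : ∀ i, (F i).eval 0 = 1) {z : ι}
    (hval : ∀ i, i ≠ z → F i ∈ IntValued)
    (L : Multiset IntValued) (hL : ∀ g ∈ L, Irreducible g) {T : Finset ι} {ε : ℤˣ} (hz : z ∈ T)
    (h : (L.prod : ℚ[X]) = ((ε : ℤ) : ℚ[X]) * ∏ i ∈ T, F i) :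
    ∃ J ⊆ T, z ∈ J ∧ ∏ i ∈ J, F i ∈ IntValued ∧
      (∀ s ⊆ J, z ∈ s → ∏ i ∈ s, F i ∈ IntValued → J = s) ∧
      L.map Associates.mk = (groupedFactors F J T).map Associates.mk := by
  induction L using Multiset.induction generalizing T ε with
  | empty =>
    have : IsUnit (∏ i ∈ T, F i) := by
      apply isUnit_of_mul_isUnit_right (x := ((ε : ℤ) : ℚ[X]))
      rw [← h]
      simp
    simp [eq_empty_of_isUnit_prod hF this] at hz
  | cons a L ih =>
    have hirr := hL a (Multiset.mem_cons_self a L)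
    have hL' : ∀ g ∈ L, Irreducible g := fun g hg => hL g (Multiset.mem_cons_of_mem hg)
    rw [Multiset.prod_cons, Subring.coe_mul] at h
    obtain ⟨t, v, δ, γ, rfl, hd, ha, hb⟩ := exists_eq_mul_prod hF h0 h
    have hmk := mk_eq_mk_prodAtom ha
    by_cases hzt : z ∈ t
    · refine ⟨t, Finset.subset_union_left, hzt, hmk.1, fun s hs hzs hsI => ?_, ?_⟩
      · exact eq_of_irreducible hF hirr ha hs (Finset.ne_empty_of_mem hzs) hsI
          (prod_mem_intValued hval fun hmem => (Finset.mem_sdiff.1 hmem).2 hzs)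
      · rw [Multiset.map_cons, map_mk_eq_of_prod_eq hF h0 hval L hL'
          (Finset.disjoint_left.1 hd hzt) hb, hmk.2, groupedFactors,
          Finset.union_sdiff_cancel_left hd, Multiset.map_cons, Multiset.map_map]
        rfl
    · obtain ⟨j, rfl⟩ := exists_eq_singleton hF hval hirr hzt ha
      obtain ⟨J, hJ, hzJ, hJI, hmin, hmap⟩ :=
        ih hL' ((Finset.mem_union.1 hz).resolve_left hzt) hb
      have hj : j ∉ v := Finset.disjoint_singleton_left.1 hd
      refine ⟨J, hJ.trans Finset.subset_union_right, hzJ, hJI, hmin, ?_⟩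
      rw [Multiset.map_cons, hmap, hmk.2, groupedFactors, groupedFactors, ← Finset.insert_eq,
        Finset.insert_sdiff_of_notMem _ fun hjJ => hj (hJ hjJ),
        Finset.insert_val_of_notMem fun hmem => hj (Finset.mem_sdiff.1 hmem).1]
      simp only [Multiset.map_cons]
      rw [Multiset.cons_swap]

theorem prod_groupedFactors {ι : Type*} [DecidableEq ι] {F : ι → ℚ[X]} {z : ι}
    (hval : ∀ i, i ≠ z → F i ∈ IntValued) {J T : Finset ι} (hJT : J ⊆ T) (hz : z ∈ J)
    (hJ : ∏ i ∈ J, F i ∈ IntValued) :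
    ((groupedFactors F J T).prod : ℚ[X]) = ∏ i ∈ T, F i := by
  have hsingle : ∀ i ∈ T \ J, (prodAtom F {i} : ℚ[X]) = F i := by
    intro i hi
    rw [coe_prodAtom, Finset.prod_singleton]
    rw [Finset.prod_singleton]
    exact hval i (by rintro rfl; exact (Finset.mem_sdiff.1 hi).2 hz)
  rw [groupedFactors, Multiset.prod_cons, Subring.coe_mul, coe_prodAtom hJ,
    ← Finset.prod_sdiff hJT, mul_comm, ← Finset.prod_congr rfl hsingle]
  congr 1
  exact map_prod IntValued.subtype (fun i => prodAtom F {i}) (T \ J)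

theorem irreducible_of_mem_groupedFactors {ι : Type*} [DecidableEq ι] {F : ι → ℚ[X]}
    (hF : ∀ i, Prime (F i)) (h0 : ∀ i, (F i).eval 0 = 1) {z : ι}
    (hval : ∀ i, i ≠ z → F i ∈ IntValued) {J T : Finset ι} (hz : z ∈ J)
    (hJ : ∏ i ∈ J, F i ∈ IntValued)
    (hmin : ∀ t ⊆ J, z ∈ t → ∏ i ∈ t, F i ∈ IntValued → t = J) :
    ∀ g ∈ groupedFactors F J T, Irreducible g := by
  intro g hg
  rcases Multiset.mem_cons.1 hg with rfl | hg
  · exact irreducible_prodAtom hF h0 hz hJ hmin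
  · obtain ⟨i, hi, rfl⟩ := Multiset.mem_map.1 hg
    refine irreducible_prodAtom_singleton hF h0 (hval i ?_)
    rintro rfl
    exact (Finset.mem_sdiff.1 hi).2 hz

theorem irreducible_reverse {K : Type*} [Field K] {f : K[X]} (hf : Irreducible f)
    (h0 : f.coeff 0 ≠ 0) : Irreducible f.reverse := by
  have hrev : ∀ {q : K[X]}, q.coeff 0 ≠ 0 → q.reverse.natDegree = q.natDegree := fun {q} hq => by
    rw [reverse_natDegree, natTrailingDegree_eq_zero.2 (Or.inr hq), Nat.sub_zero]
  have hunit : ∀ {q : K[X]}, q.coeff 0 ≠ 0 → (IsUnit q.reverse ↔ IsUnit q) := fun {q} hq => by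
    have hq0 : q ≠ 0 := by rintro rfl; simp at hq
    have hq1 : q.reverse ≠ 0 := fun h => hq0 (reverse_eq_zero.1 h)
    rw [isUnit_iff_degree_eq_zero, isUnit_iff_degree_eq_zero, degree_eq_natDegree hq0,
      degree_eq_natDegree hq1, hrev hq]
  refine ⟨fun h => hf.not_isUnit ((hunit h0).1 h), fun a b hab => ?_⟩
  have hfab : f = a.reverse * b.reverse := by
    rw [← reverse_mul_of_domain, ← hab, reverse, hrev h0, reverse, reflect_reflect]
  have hc : a.coeff 0 * b.coeff 0 ≠ 0 := by
    rw [← mul_coeff_zero, ← hab, coeff_zero_reverse]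
    exact leadingCoeff_ne_zero.2 hf.ne_zero
  rw [← hunit (left_ne_zero_of_mul hc), ← hunit (right_ne_zero_of_mul hc)]
  exact hf.isUnit_or_isUnit hfab

/-- A monic polynomial, Eisenstein at `2` for odd `p`, congruent mod `p` to a product of linear
factors. -/
noncomputable def eisensteinPoly (p d : ℕ) : ℤ[X] :=
  ∏ k ∈ Finset.Icc 1 d, (X + C (4 * k : ℤ)) + C (2 * p : ℤ)

theorem natDegree_prod_X_add_C (d : ℕ) :
    (∏ k ∈ Finset.Icc 1 d, (X + C (4 * k : ℤ))).natDegree = d := by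
  rw [natDegree_prod_of_monic _ _ fun k _ => monic_X_add_C _]
  simp only [natDegree_X_add_C]
  simp

theorem monic_prod_X_add_C (d : ℕ) : (∏ k ∈ Finset.Icc 1 d, (X + C (4 * k : ℤ))).Monic :=
  monic_prod_of_monic _ _ fun _ _ => monic_X_add_C _

theorem natDegree_eisensteinPoly (p d : ℕ) : (eisensteinPoly p d).natDegree = d := by
  rw [eisensteinPoly, natDegree_add_C, natDegree_prod_X_add_C]

theorem monic_eisensteinPoly (p : ℕ) {d : ℕ} (hd : 1 ≤ d) : (eisensteinPoly p d).Monic := by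
  refine (monic_prod_X_add_C d).add_of_left (degree_C_le.trans_lt ?_)
  rw [← natDegree_pos_iff_degree_pos, natDegree_prod_X_add_C]
  exact hd

theorem four_dvd_prod {d : ℕ} (hd : 1 ≤ d) : (4 : ℤ) ∣ ∏ k ∈ Finset.Icc 1 d, (4 * k : ℤ) :=
  (dvd_mul_right 4 _).trans
    (Finset.dvd_prod_of_mem (fun k : ℕ => (4 * k : ℤ)) (Finset.mem_Icc.2 ⟨le_refl 1, hd⟩))

theorem coeff_zero_eisensteinPoly (p d : ℕ) :
    (eisensteinPoly p d).coeff 0 = ∏ k ∈ Finset.Icc 1 d, (4 * k : ℤ) + 2 * p := by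
  simp [eisensteinPoly, coeff_zero_eq_eval_zero, eval_prod]

theorem not_four_dvd_coeff_zero_eisensteinPoly {p d : ℕ} (hp : Odd p) (hd : 1 ≤ d) :
    ¬ (4 : ℤ) ∣ (eisensteinPoly p d).coeff 0 := by
  rw [coeff_zero_eisensteinPoly, dvd_add_right (four_dvd_prod hd)]
  obtain ⟨m, rfl⟩ := hp
  push_cast
  omega

theorem irreducible_eisensteinPoly {p d : ℕ} (hp : Odd p) (hd : 1 ≤ d) :
    Irreducible (eisensteinPoly p d) := by
  have hmap : (eisensteinPoly p d).map (Int.castRingHom (ZMod 2)) = X ^ d := by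
    have h2 : ((2 * p : ℤ) : ZMod 2) = 0 :=
      (ZMod.intCast_zmod_eq_zero_iff_dvd _ 2).2 ⟨p, by push_cast; ring⟩
    have h4 : ∀ k : ℕ, ((4 * k : ℤ) : ZMod 2) = 0 := fun k =>
      (ZMod.intCast_zmod_eq_zero_iff_dvd _ 2).2 ⟨2 * k, by push_cast; ring⟩
    simp only [eisensteinPoly, Polynomial.map_add, Polynomial.map_prod, map_X, map_C,
      Int.coe_castRingHom, h2, h4, C_0, add_zero]
    simp
  have hmonic := monic_eisensteinPoly p hd
  refine irreducible_of_eisenstein_criterion (P := Ideal.span {2})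
    ((Ideal.span_singleton_prime two_ne_zero).2 Int.prime_two) ?_ (fun m hm => ?_) ?_ ?_
    hmonic.isPrimitive
  · rw [hmonic.leadingCoeff, Ideal.mem_span_singleton]
    decide
  · have hm' : m < d := by
      rw [← natDegree_eisensteinPoly p d]
      exact coe_lt_degree.1 hm
    have h := congrArg (fun q => q.coeff m) hmap
    simp only [coeff_map, coeff_X_pow, hm'.ne, if_false] at h
    rw [Ideal.mem_span_singleton]
    exact_mod_cast (ZMod.intCast_zmod_eq_zero_iff_dvd _ 2).1 h
  · rw [← natDegree_pos_iff_degree_pos, natDegree_eisensteinPoly]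
    exact hd
  · rw [Ideal.span_singleton_pow, Ideal.mem_span_singleton]
    exact not_four_dvd_coeff_zero_eisensteinPoly hp hd

/-- The reversal of `eisensteinPoly` over `ℚ`; it takes the value `1` at `0`. -/
noncomputable def coverPoly (p d : ℕ) : ℚ[X] :=
  ((eisensteinPoly p d).map (Int.castRingHom ℚ)).reverse

theorem irreducible_coverPoly {p d : ℕ} (hp : Odd p) (hd : 1 ≤ d) :
    Irreducible (coverPoly p d) := by
  refine irreducible_reverse ?_ ?_
  · exact (IsPrimitive.Int.irreducible_iff_irreducible_map_cast
      (monic_eisensteinPoly p hd).isPrimitive).1 (irreducible_eisensteinPoly hp hd)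
  · rw [coeff_map]
    intro h
    apply not_four_dvd_coeff_zero_eisensteinPoly hp hd
    have : (eisensteinPoly p d).coeff 0 = 0 := by simpa using h
    simp [this]

theorem eval_coverPoly (p : ℕ) {d : ℕ} (hd : 1 ≤ d) (x : ℚ) :
    (coverPoly p d).eval x = ∏ k ∈ Finset.Icc 1 d, (1 + 4 * k * x) + 2 * p * x ^ d := by
  have hmonic := (monic_eisensteinPoly p hd).map (Int.castRingHom ℚ)
  rcases eq_or_ne x 0 with rfl | hx
  · rw [← coeff_zero_eq_eval_zero, coverPoly, coeff_zero_reverse, hmonic.leadingCoeff]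
    simp [Nat.one_le_iff_ne_zero.1 hd]
  · have hdeg : ((eisensteinPoly p d).map (Int.castRingHom ℚ)).natDegree = d := by
      rw [(monic_eisensteinPoly p hd).natDegree_map, natDegree_eisensteinPoly]
    let _ : Invertible x⁻¹ := invertibleOfNonzero (inv_ne_zero hx)
    have h := eval₂_reverse_mul_pow (RingHom.id ℚ) x⁻¹
      ((eisensteinPoly p d).map (Int.castRingHom ℚ))
    rw [invOf_eq_inv, inv_inv, hdeg, eval₂_id, eval₂_id, inv_pow] at h
    have hxd : x ^ d ≠ 0 := pow_ne_zero d hx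
    have hcard : x ^ d = ∏ _k ∈ Finset.Icc 1 d, x := by simp
    rw [← div_eq_mul_inv, div_eq_iff hxd] at h
    rw [coverPoly, h]
    simp only [eisensteinPoly, eval_map, eval₂_add, eval₂_finsetProd, eval₂_X, eval₂_C, add_mul]
    congr 1
    · rw [hcard, ← Finset.prod_mul_distrib]
      refine Finset.prod_congr rfl fun k _ => ?_
      simp
      field_simp
    · simp

/-- The irreducible factors, normalized to take the value `1` at `0`. -/
noncomputable def factorFamily (p d i : ℕ) : ℚ[X] :=
  if i = 0 then C (p : ℚ)⁻¹ * X + C 1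
  else if i = p then coverPoly p d
  else C (4 * i : ℚ) * X + C 1

/-- The values of `factorFamily p d i` at integers for `i ≠ 0`. -/
def factorValue (p d i : ℕ) (c : ℤ) : ℤ :=
  if i = p then ∏ k ∈ Finset.Icc 1 d, (1 + 4 * k * c) + 2 * p * c ^ d
  else 1 + 4 * i * c

theorem eval_factorFamily (p : ℕ) {d i : ℕ} (hd : 1 ≤ d) (hi : i ≠ 0) (c : ℤ) :
    (factorFamily p d i).eval (c : ℚ) = factorValue p d i c := by
  unfold factorFamily factorValue
  rw [if_neg hi]
  split_ifs
  · rw [eval_coverPoly p hd]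
    push_cast
    rfl
  · simp [add_comm]

theorem eval_factorFamily_zero (p d : ℕ) (x : ℚ) :
    (factorFamily p d 0).eval x = (p : ℚ)⁻¹ * x + 1 := by
  simp [factorFamily]

theorem factorFamily_mem (p : ℕ) {d : ℕ} (hd : 1 ≤ d) (i : ℕ) (hi : i ≠ 0) :
    factorFamily p d i ∈ IntValued :=
  fun c => ⟨_, eval_factorFamily p hd hi c⟩

theorem prime_factorFamily {p d : ℕ} (hp : Odd p) (hd : 1 ≤ d) (i : ℕ) :
    Prime (factorFamily p d i) := by
  rw [← irreducible_iff_prime]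
  unfold factorFamily
  split_ifs with h0 h1
  · refine irreducible_of_degree_eq_one (degree_linear (inv_ne_zero ?_))
    exact_mod_cast hp.pos.ne'
  · exact irreducible_coverPoly hp hd
  · refine irreducible_of_degree_eq_one (degree_linear ?_)
    simpa using h0

theorem eval_zero_factorFamily (p : ℕ) {d : ℕ} (hd : 1 ≤ d) (i : ℕ) :
    (factorFamily p d i).eval 0 = 1 := by
  rcases eq_or_ne i 0 with rfl | hi
  · simp [eval_factorFamily_zero]
  · have h := eval_factorFamily p hd hi 0
    rw [Int.cast_zero] at h
    rw [h, factorValue]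
    split_ifs <;> simp [Nat.one_le_iff_ne_zero.1 hd]

theorem eval_prod_factorFamily (p : ℕ) {d : ℕ} (hd : 1 ≤ d) {J : Finset ℕ} (h0 : 0 ∈ J) (c : ℤ) :
    (∏ i ∈ J, factorFamily p d i).eval (c : ℚ) =
      ((p : ℚ)⁻¹ * c + 1) * ((∏ i ∈ J.erase 0, factorValue p d i c : ℤ) : ℚ) := by
  rw [← Finset.mul_prod_erase J _ h0, eval_mul, eval_factorFamily_zero, eval_prod]
  push_cast
  congr 1
  exact Finset.prod_congr rfl fun i hi => eval_factorFamily p hd (Finset.ne_of_mem_erase hi) c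

theorem not_dvd_four {p : ℕ} (hp : p.Prime) (hodd : Odd p) : ¬ (p : ℤ) ∣ 4 := by
  intro h
  have h2 : p ∣ 2 ^ 2 := by exact_mod_cast h
  have h3 := (Nat.prime_dvd_prime_iff_eq hp Nat.prime_two).1 (hp.dvd_of_dvd_pow h2)
  rw [h3] at hodd
  exact absurd hodd (by decide)

theorem exists_dvd_one_add {p : ℕ} (hp : p.Prime) (hodd : Odd p) {m : ℤ} (hm : ¬ (p : ℤ) ∣ m) :
    ∃ j : ℕ, 1 ≤ j ∧ j < p ∧ (p : ℤ) ∣ 1 + 4 * j * m := by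
  have := Fact.mk hp
  have h4 : ((4 * m : ℤ) : ZMod p) ≠ 0 := by
    rw [Ne, ZMod.intCast_zmod_eq_zero_iff_dvd]
    exact fun h => ((Nat.prime_iff_prime_int.1 hp).dvd_or_dvd h).elim (not_dvd_four hp hodd) hm
  set y : ZMod p := -((4 * m : ℤ) : ZMod p)⁻¹
  have hy : y ≠ 0 := neg_ne_zero.2 (inv_ne_zero h4)
  refine ⟨y.val, Nat.one_le_iff_ne_zero.2 fun h => hy ((ZMod.val_eq_zero y).1 h),
    ZMod.val_lt y, ?_⟩
  rw [← ZMod.intCast_zmod_eq_zero_iff_dvd]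
  have : ((1 + 4 * (y.val : ℤ) * m : ℤ) : ZMod p) = 1 + y * ((4 * m : ℤ) : ZMod p) := by
    push_cast
    rw [ZMod.natCast_zmod_val]
    ring
  rw [this, neg_mul, inv_mul_cancel₀ h4, add_neg_cancel]

theorem eq_of_dvd_one_add {p : ℕ} (hp : p.Prime) (hodd : Odd p) {i j : ℕ} {c : ℤ} (hi : i < p)
    (hj : j < p) (h1 : (p : ℤ) ∣ 1 + 4 * i * c) (h2 : (p : ℤ) ∣ 1 + 4 * j * c) : i = j := by
  have hpz := Nat.prime_iff_prime_int.1 hp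
  have hc : ¬ (p : ℤ) ∣ c := fun h =>
    hpz.not_dvd_one ((dvd_add_left (h.mul_left _)).1 h1)
  have h : (p : ℤ) ∣ 4 * (c * (i - j)) := by
    have := dvd_sub h1 h2
    ring_nf at this ⊢
    exact this
  have h3 := ((hpz.dvd_or_dvd h).resolve_left (not_dvd_four hp hodd))
  have h4 := (hpz.dvd_or_dvd h3).resolve_left hc
  have := Int.eq_zero_of_abs_lt_dvd h4 (by rw [abs_lt]; omega)
  omega

theorem dvd_factorValue_self {p d : ℕ} {j : ℕ} (hj : 1 ≤ j) (hjd : j ≤ d) {c : ℤ}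
    (h : (p : ℤ) ∣ 1 + 4 * j * c) : (p : ℤ) ∣ factorValue p d p c := by
  rw [factorValue, if_pos rfl]
  refine dvd_add (h.trans ?_) ⟨2 * c ^ d, by ring⟩
  exact Finset.dvd_prod_of_mem (fun k : ℕ => (1 + 4 * k * c : ℤ)) (Finset.mem_Icc.2 ⟨hj, hjd⟩)

/-- A product containing the index `0` is integer-valued as soon as every nonzero residue class
mod `p` consists of zeros mod `p` of some other factor. -/
theorem prod_factorFamily_mem {p d : ℕ} (hp : p.Prime) (hodd : Odd p) (hd : 1 ≤ d)
    {J : Finset ℕ} (h0 : 0 ∈ J)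
    (hJ : ∀ j, 1 ≤ j → j < p → j ∈ J ∨ p ∈ J ∧ j ≤ d) :
    ∏ i ∈ J, factorFamily p d i ∈ IntValued := by
  intro c
  have hp0 : (p : ℚ) ≠ 0 := by exact_mod_cast hp.ne_zero
  rw [eval_prod_factorFamily p hd h0]
  by_cases hc : (p : ℤ) ∣ c
  · obtain ⟨m, rfl⟩ := hc
    refine ⟨(m + 1) * ∏ i ∈ J.erase 0, factorValue p d i (p * m), ?_⟩
    push_cast
    field_simp
  · obtain ⟨j, hj1, hjp, hj⟩ := exists_dvd_one_add hp hodd hc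
    have hdvd : (p : ℤ) ∣ ∏ i ∈ J.erase 0, factorValue p d i c := by
      rcases hJ j hj1 hjp with h | ⟨h, hjd⟩
      · refine Dvd.dvd.trans ?_ (Finset.dvd_prod_of_mem _ (Finset.mem_erase.2 ⟨by omega, h⟩))
        rwa [factorValue, if_neg hjp.ne]
      · exact (dvd_factorValue_self hj1 hjd hj).trans
          (Finset.dvd_prod_of_mem _ (Finset.mem_erase.2 ⟨hp.ne_zero, h⟩))
    obtain ⟨m, hm⟩ := hdvd
    refine ⟨(c + p) * m, ?_⟩
    rw [hm]
    push_cast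
    field_simp

theorem mem_or_of_prod_factorFamily_mem {p d : ℕ} (hp : p.Prime) (hodd : Odd p) (hd : 1 ≤ d)
    (hdp : d < p) {J : Finset ℕ} (h0 : 0 ∈ J) (hJp : J ⊆ Finset.range (p + 1))
    (hJ : ∏ i ∈ J, factorFamily p d i ∈ IntValued) {j : ℕ} (hj1 : 1 ≤ j) (hjp : j < p) :
    j ∈ J ∨ p ∈ J ∧ j ≤ d := by
  have hpz := Nat.prime_iff_prime_int.1 hp
  have hp0 : (p : ℚ) ≠ 0 := by exact_mod_cast hp.ne_zero
  have hndvd : ¬ (p : ℤ) ∣ j := fun h =>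
    absurd (Nat.le_of_dvd hj1 (by exact_mod_cast h)) (by omega)
  obtain ⟨c, -, -, hcj⟩ := exists_dvd_one_add hp hodd hndvd
  have hdvd : (p : ℤ) ∣ 1 + 4 * j * c := by
    convert hcj using 1
    ring
  have hc : ¬ (p : ℤ) ∣ c := fun h =>
    hpz.not_dvd_one ((dvd_add_left (h.mul_left _)).1 hdvd)
  obtain ⟨m, hm⟩ := hJ c
  rw [eval_prod_factorFamily p hd h0] at hm
  have hm' : ((c : ℤ) + p) * ∏ i ∈ J.erase 0, factorValue p d i c = p * m := by
    have : ((c : ℚ) + p) * ((∏ i ∈ J.erase 0, factorValue p d i c : ℤ) : ℚ) = p * m := by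
      rw [← hm]
      push_cast
      field_simp
    exact_mod_cast this
  have h1 : (p : ℤ) ∣ ∏ i ∈ J.erase 0, factorValue p d i c :=
    (hpz.dvd_or_dvd ⟨m, hm'⟩).resolve_left fun h => hc ((dvd_add_left (dvd_refl _)).1 h)
  obtain ⟨i, hi, h2⟩ := (hpz.dvd_finsetProd_iff _).1 h1
  obtain ⟨hi0, hiJ⟩ := Finset.mem_erase.1 hi
  have hip := Finset.mem_range.1 (hJp hiJ)
  rw [factorValue] at h2
  split_ifs at h2 with h
  · subst h
    refine Or.inr ⟨hiJ, ?_⟩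
    rw [dvd_add_left ⟨2 * (c : ℤ) ^ d, by ring⟩, hpz.dvd_finsetProd_iff] at h2
    obtain ⟨k, hk, h3⟩ := h2
    have hk' := Finset.mem_Icc.1 hk
    rw [eq_of_dvd_one_add hp hodd hjp (by omega) hdvd h3]
    exact hk'.2
  · left
    rwa [eq_of_dvd_one_add hp hodd hjp (by omega) hdvd h2]

/-- For every `n ≥ 0` there is `H ∈ Int(ℤ)` having exactly two essentially
different factorizations into irreducibles, one of length `2` and one of length
`n + 2`; in particular its set of lengths is `{2, n + 2}`. -/
theorem two_factorizations (n : ℕ) :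
    ∃ H : IntValued, ∃ M₁ M₂ : Multiset IntValued,
      (∀ g ∈ M₁, Irreducible g) ∧ (∀ g ∈ M₂, Irreducible g) ∧
      Multiset.card M₁ = 2 ∧ Multiset.card M₂ = n + 2 ∧
      M₁.prod = H ∧ M₂.prod = H ∧
      M₁.map Associates.mk ≠ M₂.map Associates.mk ∧
      (∀ L : Multiset IntValued, (∀ g ∈ L, Irreducible g) → L.prod = H →
        L.map Associates.mk = M₁.map Associates.mk ∨
          L.map Associates.mk = M₂.map Associates.mk) ∧
      (∀ k : ℕ,
        (∃ L : Multiset IntValued, Multiset.card L = k ∧ (∀ g ∈ L, Irreducible g) ∧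
            L.prod = H)
          ↔ (k = 2 ∨ k = n + 2)) := by
  obtain ⟨p, hpn, hp⟩ := Nat.exists_infinite_primes (n + 3)
  have hodd : Odd p := hp.odd_of_ne_two (by omega)
  have hd : 1 ≤ n + 1 := by omega
  set F := factorFamily p (n + 1) with hFdef
  have hF : ∀ i, Prime (F i) := prime_factorFamily hodd hd
  have h0 : ∀ i, (F i).eval 0 = 1 := eval_zero_factorFamily p hd
  have hval : ∀ i, i ≠ 0 → F i ∈ IntValued := factorFamily_mem p hd
  set S := Finset.range (p + 1) with hS
  set J₁ := Finset.range p with hJ₁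
  set J₂ := insert 0 (Finset.Icc (n + 2) p) with hJ₂
  have hJ₁S : J₁ ⊆ S := Finset.range_subset_range.2 (Nat.le_succ p)
  have hJ₂S : J₂ ⊆ S := fun i hi => by
    simp only [hJ₂, hS, Finset.mem_insert, Finset.mem_Icc, Finset.mem_range] at hi ⊢
    omega
  have hz₁ : 0 ∈ J₁ := Finset.mem_range.2 hp.pos
  have hz₂ : 0 ∈ J₂ := Finset.mem_insert_self _ _
  have hI₁ : ∏ i ∈ J₁, F i ∈ IntValued :=
    prod_factorFamily_mem hp hodd hd hz₁ fun j _ hj => Or.inl (Finset.mem_range.2 hj)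
  have hI₂ : ∏ i ∈ J₂, F i ∈ IntValued :=
    prod_factorFamily_mem hp hodd hd hz₂ fun j _ hj => by
      simp only [hJ₂, Finset.mem_insert, Finset.mem_Icc]
      omega
  have hcover : ∀ t ⊆ S, 0 ∈ t → ∏ i ∈ t, F i ∈ IntValued → J₁ ⊆ t ∨ J₂ ⊆ t := by
    intro t htS hzt ht
    have key : ∀ j, 1 ≤ j → j < p → j ∈ t ∨ p ∈ t ∧ j ≤ n + 1 := fun j hj1 hjp =>
      mem_or_of_prod_factorFamily_mem hp hodd hd (by omega) hzt htS ht hj1 hjp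
    by_cases hpt : p ∈ t
    · refine Or.inr fun i hi => ?_
      simp only [hJ₂, Finset.mem_insert, Finset.mem_Icc] at hi
      rcases hi with rfl | hi
      · exact hzt
      · rcases hi.2.eq_or_lt with rfl | hip
        · exact hpt
        · exact (key i (by omega) hip).resolve_right fun h => by omega
    · refine Or.inl fun i hi => ?_
      rcases Nat.eq_zero_or_pos i with rfl | hi0
      · exact hzt
      · exact (key i hi0 (Finset.mem_range.1 hi)).resolve_right fun h => hpt h.1
  have hmin₁ : ∀ t ⊆ J₁, 0 ∈ t → ∏ i ∈ t, F i ∈ IntValued → t = J₁ := by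
    intro t ht hzt hI
    rcases hcover t (ht.trans hJ₁S) hzt hI with h | h
    · exact ht.antisymm h
    · have hmem : p ∈ J₂ := Finset.mem_insert_of_mem (Finset.mem_Icc.2 ⟨by omega, le_refl p⟩)
      exact absurd (Finset.mem_range.1 (ht (h hmem))) (lt_irrefl p)
  have hmin₂ : ∀ t ⊆ J₂, 0 ∈ t → ∏ i ∈ t, F i ∈ IntValued → t = J₂ := by
    intro t ht hzt hI
    rcases hcover t (ht.trans hJ₂S) hzt hI with h | h
    · have hmem := ht (h (Finset.mem_range.2 (by omega : 1 < p)))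
      simp only [hJ₂, Finset.mem_insert, Finset.mem_Icc] at hmem
      omega
    · exact ht.antisymm h
  set M₁ := groupedFactors F J₁ S with hM₁
  set M₂ := groupedFactors F J₂ S with hM₂
  have hirr₁ : ∀ g ∈ M₁, Irreducible g :=
    irreducible_of_mem_groupedFactors hF h0 hval hz₁ hI₁ hmin₁
  have hirr₂ : ∀ g ∈ M₂, Irreducible g :=
    irreducible_of_mem_groupedFactors hF h0 hval hz₂ hI₂ hmin₂
  have hprod₁ := prod_groupedFactors hval hJ₁S hz₁ hI₁
  have hprod₂ := prod_groupedFactors hval hJ₂S hz₂ hI₂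
  have hprod : M₂.prod = M₁.prod := Subtype.ext (hprod₂.trans hprod₁.symm)
  have hcard₁ : Multiset.card M₁ = 2 := by
    have : S.card = J₁.card + 1 := by simp [hS, hJ₁]
    simp only [hM₁, groupedFactors, Multiset.card_cons, Multiset.card_map, Finset.card_val,
      Finset.card_sdiff_of_subset hJ₁S]
    omega
  have hcard₂ : Multiset.card M₂ = n + 2 := by
    have h1 : S.card = p + 1 := by simp [hS]
    have h2 : J₂.card = (p + 1 - (n + 2)) + 1 := by
      rw [hJ₂, Finset.card_insert_of_notMem (by simp), Nat.card_Icc]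
    simp only [hM₂, groupedFactors, Multiset.card_cons, Multiset.card_map, Finset.card_val,
      Finset.card_sdiff_of_subset hJ₂S]
    omega
  have hclass : ∀ L : Multiset IntValued, (∀ g ∈ L, Irreducible g) → L.prod = M₁.prod →
      L.map Associates.mk = M₁.map Associates.mk ∨
        L.map Associates.mk = M₂.map Associates.mk := by
    intro L hL hLprod
    have h : (L.prod : ℚ[X]) = (((1 : ℤˣ) : ℤ) : ℚ[X]) * ∏ i ∈ S, F i := by
      rw [hLprod, hprod₁]
      simp
    obtain ⟨J, hJS, hzJ, hJI, hJmin, hmap⟩ :=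
      exists_map_mk_eq_groupedFactors hF h0 hval L hL (Finset.mem_range.2 (by omega)) h
    rcases hcover J hJS hzJ hJI with hsub | hsub
    · left; rw [hmap, hJmin J₁ hsub hz₁ hI₁]
    · right; rw [hmap, hJmin J₂ hsub hz₂ hI₂]
  refine ⟨M₁.prod, M₁, M₂, hirr₁, hirr₂, hcard₁, hcard₂, rfl, hprod, ?_, hclass, fun k => ?_⟩
  · intro heq
    have hmem : Associates.mk (prodAtom F J₁) ∈ M₂.map Associates.mk :=
      heq ▸ Multiset.mem_map_of_mem _ (Multiset.mem_cons_self _ _)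
    have hvanish : ∀ {t : Finset ℕ}, ∏ i ∈ t, F i ∈ IntValued →
        Associates.mk (prodAtom F t) = Associates.mk (prodAtom F J₁) →
        ∀ x : ℚ, ∀ i ∈ J₁, (F i).eval x = 0 → ∃ j ∈ t, (F j).eval x = 0 := by
      intro t ht hmk x i hi hx
      have hass := ((Associates.mk_eq_mk_iff_associated.1 hmk).map IntValued.subtype).symm.dvd
      simp only [Subring.subtype_apply, coe_prodAtom ht, coe_prodAtom hI₁] at hass
      have hdvd := (eval_dvd ((Finset.dvd_prod_of_mem F hi).trans hass) : _ ∣ eval x _)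
      rwa [hx, zero_dvd_iff, eval_prod, Finset.prod_eq_zero_iff] at hdvd
    obtain ⟨g, hg, hmk⟩ := Multiset.mem_map.1 hmem
    rcases Multiset.mem_cons.1 hg with rfl | hg
    · have hone : (F 1).eval (-1 / 4) = 0 := by
        rw [hFdef, factorFamily, if_neg one_ne_zero, if_neg (by omega)]
        simp only [eval_add, eval_mul, eval_C, eval_X]
        norm_num
      obtain ⟨j, hj, hj0⟩ :=
        hvanish hI₂ hmk (-1 / 4) 1 (Finset.mem_range.2 (by omega)) hone
      have hp3 : (3 : ℚ) ≤ p := by exact_mod_cast (by omega : 3 ≤ p)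
      rw [hFdef, factorFamily] at hj0
      split_ifs at hj0 with hjz hjp
      · simp only [eval_add, eval_mul, eval_C, eval_X] at hj0
        field_simp at hj0
        linarith
      · rw [eval_coverPoly p hd, Finset.prod_eq_zero (i := 1) (by simp) (by norm_num),
          zero_add] at hj0
        have : (2 * p : ℚ) * (-1 / 4) ^ (n + 1) ≠ 0 :=
          mul_ne_zero (by linarith) (pow_ne_zero _ (by norm_num))
        exact this hj0
      · simp only [eval_add, eval_mul, eval_C, eval_X] at hj0
        have : (j : ℚ) = 1 := by linarith
        have hj1 : j = 1 := by exact_mod_cast this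
        simp [hJ₂, hj1] at hj
    · obtain ⟨j, hj, rfl⟩ := Multiset.mem_map.1 hg
      obtain ⟨hjS, hj2⟩ := Finset.mem_sdiff.1 (Finset.mem_def.2 hj)
      simp only [hJ₂, hS, Finset.mem_insert, Finset.mem_Icc, Finset.mem_range] at hjS hj2
      have hzero : (F 0).eval (-p : ℚ) = 0 := by
        rw [hFdef, eval_factorFamily_zero]
        field_simp [hp.ne_zero]
        simp
      obtain ⟨i, hi, hi0⟩ := hvanish (by simpa using hval j (by omega)) hmk (-p) 0 hz₁ hzero
      rw [Finset.mem_singleton.1 hi, hFdef, factorFamily, if_neg (by omega),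
        if_neg (by omega)] at hi0
      simp only [eval_add, eval_mul, eval_C, eval_X] at hi0
      have hval0 : (4 * j * p : ℤ) = 1 := by
        have : (4 * j * p : ℚ) = 1 := by linarith
        exact_mod_cast this
      have : (4 : ℤ) ∣ 1 := ⟨j * p, by rw [← hval0]; ring⟩
      omega
  · constructor
    · rintro ⟨L, rfl, hL, hLprod⟩
      rcases hclass L hL hLprod with h | h
      · left
        simpa [hcard₁] using congrArg Multiset.card h
      · right
        simpa [hcard₂] using congrArg Multiset.card h
    · rintro (rfl | rfl)
      · exact ⟨M₁, hcard₁, hirr₁, rfl⟩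
      · exact ⟨M₂, hcard₂, hirr₂, hprod⟩
end

section
/- For all natural numbers m, n with 1 ≤ m ≤ n, there exists a polynomial H ∈ Int(ℤ) that has in Int(ℤ) a factorization into m + 1 irreducibles and an essentially different factorization into n + 1 irreducibles, and no other essentially different factorization into irreducibles. -/
open Polynomial

namespace IntValued

/-- A divisor of a product of irreducibles is, up to a unit, a subproduct. -/
theorem exists_subset_associated_prod_of_dvd {ι M : Type*} [DecidableEq ι]
    [CommMonoidWithZero M] [IsCancelMulZero M] [DecompositionMonoid M] (f : ι → M)
    (hf : ∀ i, Irreducible (f i)) (J : Finset ι) {a : M} (ha : a ∣ ∏ i ∈ J, f i) :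
    ∃ A ⊆ J, Associated a (∏ i ∈ A, f i) := by
  induction J using Finset.induction_on generalizing a with
  | empty => exact ⟨∅, subset_rfl, by simpa [associated_one_iff_isUnit, isUnit_iff_dvd_one] using ha⟩
  | insert j J hj ih =>
    rw [Finset.prod_insert hj] at ha
    obtain ⟨x, y, hx, hy, rfl⟩ := exists_dvd_and_dvd_of_dvd_mul ha
    obtain ⟨A, hA, hyA⟩ := ih hy
    rcases (hf j).dvd_iff.mp hx with hu | hxj
    · exact ⟨A, hA.trans (Finset.subset_insert _ _),
        ((associated_one_iff_isUnit.mpr hu).mul_mul hyA).trans (by simp)⟩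
    · refine ⟨insert j A, Finset.insert_subset_insert _ hA, ?_⟩
      rw [Finset.prod_insert fun h => hj (hA h)]
      exact hxj.symm.mul_mul hyA

theorem coe_dvd_coe {a b : IntValued} (h : a ∣ b) : (a : ℚ[X]) ∣ b :=
  map_dvd IntValued.subtype h

theorem associated_coe {a b : IntValued} (h : Associated a b) : Associated (a : ℚ[X]) b :=
  h.map IntValued.subtype

theorem coe_multiset_prod (L : Multiset IntValued) :
    ((L.prod : IntValued) : ℚ[X]) = (L.map Subtype.val).prod :=
  map_multiset_prod IntValued.subtype L

/-- The value of `a` at `0` is `±1`. -/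
def UnitAtZero (a : IntValued) : Prop := (a : ℚ[X]).eval 0 = 1 ∨ (a : ℚ[X]).eval 0 = -1

theorem UnitAtZero.of_dvd {a b : IntValued} (hb : UnitAtZero b) (h : a ∣ b) : UnitAtZero a := by
  obtain ⟨c, rfl⟩ := h
  obtain ⟨k, hk⟩ := a.2 0
  obtain ⟨l, hl⟩ := c.2 0
  simp only [Int.cast_zero] at hk hl
  simp only [UnitAtZero, Subring.coe_mul, eval_mul, hk, hl] at hb ⊢
  have hkl : k ∣ 1 := by
    rcases hb with h | h
    · exact ⟨l, by exact_mod_cast h.symm⟩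
    · exact ⟨-l, by have : k * l = -1 := by exact_mod_cast h
                    linarith⟩
  rcases Int.isUnit_iff.mp (isUnit_of_dvd_one hkl) with rfl | rfl <;> simp

/-- A rational polynomial associated to `a`, both of value `±1` at `0`, is `±a`. -/
theorem eq_or_eq_neg_of_associated {a b : ℚ[X]} (ha : a.eval 0 = 1 ∨ a.eval 0 = -1)
    (hb : b.eval 0 = 1 ∨ b.eval 0 = -1) (h : Associated a b) : b = a ∨ b = -a := by
  obtain ⟨u, rfl⟩ := h
  obtain ⟨c, -, hc⟩ := Polynomial.isUnit_iff.mp u.isUnit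
  rw [← hc] at hb ⊢
  simp only [eval_mul, eval_C] at hb
  have : c = 1 ∨ c = -1 := by
    rcases ha with ha | ha <;> rw [ha] at hb <;> rcases hb with hb | hb
    · left; linarith
    · right; linarith
    · right; linarith
    · left; linarith
  rcases this with rfl | rfl <;> simp

theorem associated_of_associated_coe {a b : IntValued} (ha : UnitAtZero a) (hb : UnitAtZero b)
    (h : Associated (a : ℚ[X]) b) : Associated a b := by
  rcases eq_or_eq_neg_of_associated ha hb h with h | h
  · rw [Subtype.ext (a2 := a) h]
  · rw [Subtype.ext (a2 := -a) h]
    exact (Associated.refl a).neg_right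

theorem irreducible_of_irreducible_coe {a : IntValued} (ha : UnitAtZero a)
    (h : Irreducible (a : ℚ[X])) : Irreducible a where
  not_isUnit hu := h.not_isUnit (hu.map IntValued.subtype)
  isUnit_or_isUnit := by
    have key {x : IntValued} (hx : UnitAtZero x) (hu : IsUnit (x : ℚ[X])) : IsUnit x :=
      associated_one_iff_isUnit.mp (associated_of_associated_coe hx (by simp [UnitAtZero])
        (associated_one_iff_isUnit.mpr hu))
    rintro x y rfl
    exact (h.isUnit_or_isUnit rfl).imp (key (ha.of_dvd (dvd_mul_right x y)))
      (key (ha.of_dvd (dvd_mul_left y x)))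

/-- A family of integer-valued polynomials that are irreducible over `ℚ` and take the value `1`
at `0`. -/
structure IsNormalizedFamily {ι : Type*} (F : ι → IntValued) : Prop where
  irreducible_coe : ∀ i, Irreducible (F i : ℚ[X])
  eval_zero : ∀ i, (F i : ℚ[X]).eval 0 = 1

/-- The polynomial `(X + p) ∏_{i ∈ A} F i / p`. -/
noncomputable def quot {ι : Type*} (p : ℕ) (F : ι → IntValued) (A : Finset ι) : ℚ[X] :=
  C (p : ℚ)⁻¹ * ((X + C (p : ℚ)) * ∏ i ∈ A, (F i : ℚ[X]))

namespace IsNormalizedFamily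

variable {ι : Type*} {F : ι → IntValued} {p : ℕ}

theorem irreducible (hF : IsNormalizedFamily F) (i : ι) : Irreducible (F i) :=
  irreducible_of_irreducible_coe (.inl (hF.eval_zero i)) (hF.irreducible_coe i)

theorem unitAtZero_prod (hF : IsNormalizedFamily F) (A : Finset ι) :
    UnitAtZero (∏ i ∈ A, F i) := by
  left
  simp [eval_prod, hF.eval_zero]

theorem eval_zero_quot (hF : IsNormalizedFamily F) (hp : p ≠ 0) (A : Finset ι) :
    (quot p F A).eval 0 = 1 := by
  simp [quot, eval_prod, hF.eval_zero, hp]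

theorem coe_prod_ne_zero (hF : IsNormalizedFamily F) (A : Finset ι) :
    ∏ i ∈ A, (F i : ℚ[X]) ≠ 0 :=
  Finset.prod_ne_zero_iff.mpr fun i _ => (hF.irreducible_coe i).ne_zero

theorem irreducible_linear (p : ℕ) : Irreducible (X + C (p : ℚ)) := by
  simpa using irreducible_X_sub_C (-(p : ℚ))

theorem isUnit_C_inv (hp : p ≠ 0) : IsUnit (C (p : ℚ)⁻¹) :=
  isUnit_C.mpr (by simp [hp])

theorem linear_dvd_quot (A : Finset ι) : X + C (p : ℚ) ∣ quot p F A :=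
  (dvd_mul_right _ _).mul_left _

theorem quot_not_isUnit {A : Finset ι} {x : IntValued} (hx : (x : ℚ[X]) = quot p F A) :
    ¬ IsUnit x := fun hu =>
  (irreducible_linear p).not_isUnit
    (isUnit_of_dvd_unit (linear_dvd_quot A)
      (by rw [← hx]; exact hu.map IntValued.subtype))

theorem associated_quot (hp : p ≠ 0) (A : Finset ι) :
    Associated (quot p F A) ((X + C (p : ℚ)) * ∏ i ∈ A, (F i : ℚ[X])) :=
  associated_unit_mul_left _ _ (isUnit_C_inv hp)

/-- The divisors of `quot p F J` in `Int(ℤ)` that have the factor `X + p` over `ℚ`. -/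
theorem exists_associated_quot [DecidableEq ι] (hF : IsNormalizedFamily F) (hp : p ≠ 0)
    {J : Finset ι} {x a : IntValued} (hx : (x : ℚ[X]) = quot p F J) (hax : a ∣ x)
    (ha : X + C (p : ℚ) ∣ (a : ℚ[X])) :
    ∃ A ⊆ J, ∃ y : IntValued, (y : ℚ[X]) = quot p F A ∧ Associated a y := by
  have ha0 : UnitAtZero a := .of_dvd (.inl (hx ▸ hF.eval_zero_quot hp J)) hax
  obtain ⟨r, hr⟩ := ha
  have hrJ : r ∣ ∏ i ∈ J, (F i : ℚ[X]) := by
    have h := (coe_dvd_coe hax).trans (hx ▸ (associated_quot hp J).dvd)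
    rw [hr] at h
    exact (mul_dvd_mul_iff_left (irreducible_linear p).ne_zero).mp h
  obtain ⟨A, hAJ, hA⟩ := exists_subset_associated_prod_of_dvd _ hF.irreducible_coe J hrJ
  have haA : Associated (a : ℚ[X]) (quot p F A) := by
    rw [hr]
    exact (hA.mul_left _).trans (associated_quot hp A).symm
  rcases eq_or_eq_neg_of_associated ha0 (.inl (hF.eval_zero_quot hp A)) haA with h | h
  · exact ⟨A, hAJ, a, h.symm, .refl a⟩
  · exact ⟨A, hAJ, -a, h.symm, (Associated.refl a).neg_right⟩

theorem irreducible_quot [DecidableEq ι] (hF : IsNormalizedFamily F) (hp : p ≠ 0)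
    {J : Finset ι} {x : IntValued} (hx : (x : ℚ[X]) = quot p F J)
    (hmin : ∀ A ⊆ J, quot p F A ∈ IntValued → A = J) : Irreducible x := by
  have hx0 : x ≠ 0 := by
    rintro rfl
    simpa [← hx] using hF.eval_zero_quot hp J
  have key {a b : IntValued} (hab : x = a * b) (ha : X + C (p : ℚ) ∣ (a : ℚ[X])) : IsUnit b := by
    obtain ⟨A, hAJ, y, hy, hay⟩ := hF.exists_associated_quot hp hx ⟨b, hab⟩ ha
    obtain rfl := hmin A hAJ (hy ▸ y.2)
    obtain rfl : y = x := Subtype.ext (hy.trans hx.symm)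
    obtain ⟨u, hu⟩ := hay.symm
    refine .of_mul_eq_one (u : IntValued) (mul_left_cancel₀ hx0 ?_)
    calc y * (b * u) = (y * u) * b := by ring
      _ = y * 1 := by rw [hu, ← hab, mul_one]
  refine ⟨quot_not_isUnit hx, fun a b hab => ?_⟩
  have hdvd : X + C (p : ℚ) ∣ (a : ℚ[X]) * b := by
    rw [← Subring.coe_mul, ← hab, hx]
    exact linear_dvd_quot J
  rcases (irreducible_linear p).prime.dvd_or_dvd hdvd with h | h
  · exact .inr (key hab h)
  · exact .inl (key (hab.trans (mul_comm a b)) h)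

/-- The product of a normalized family factors uniquely in `Int(ℤ)`. -/
theorem map_mk_eq_of_associated_prod [DecidableEq ι] (hF : IsNormalizedFamily F) (J : Finset ι)
    {L : Multiset IntValued} (hL : ∀ g ∈ L, Irreducible g)
    (hprod : Associated L.prod (∏ i ∈ J, F i)) :
    L.map Associates.mk = (J.val.map F).map Associates.mk := by
  induction J using Finset.induction_on generalizing L with
  | empty =>
    have hu : IsUnit L.prod := associated_one_iff_isUnit.mp (by simpa using hprod)
    obtain rfl : L = 0 := Multiset.eq_zero_of_forall_notMem fun g hg =>
      (hL g hg).not_isUnit (isUnit_of_dvd_unit (Multiset.dvd_prod hg) hu)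
    simp
  | insert j J hj ih =>
    rw [Finset.prod_insert hj] at hprod
    have hdvd : (F j : ℚ[X]) ∣ (L.map Subtype.val).prod := by
      rw [← coe_multiset_prod]
      exact (coe_dvd_coe (dvd_mul_right _ _)).trans (associated_coe hprod).symm.dvd
    obtain ⟨_, hb, hjb⟩ := (hF.irreducible_coe j).prime.exists_mem_multiset_dvd hdvd
    obtain ⟨b, hbL, rfl⟩ := Multiset.mem_map.mp hb
    obtain ⟨L, rfl⟩ := Multiset.exists_cons_of_mem hbL
    rw [Multiset.prod_cons] at hprod
    have hbdvd : b ∣ F j * ∏ i ∈ J, F i := (dvd_mul_right _ _).trans hprod.dvd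
    have hb0 : UnitAtZero b := by
      refine .of_dvd ?_ hbdvd
      rw [← Finset.prod_insert hj]
      exact hF.unitAtZero_prod _
    obtain ⟨r, hr⟩ := hjb
    have hrJ : r ∣ ∏ i ∈ J, (F i : ℚ[X]) := by
      have h := coe_dvd_coe hbdvd
      rw [hr, Subring.coe_mul, mul_dvd_mul_iff_left (hF.irreducible_coe j).ne_zero] at h
      simpa using h
    obtain ⟨A, hAJ, hA⟩ := exists_subset_associated_prod_of_dvd _ hF.irreducible_coe J hrJ
    have hjA : j ∉ A := fun h => hj (hAJ h)
    have hbA : Associated b (F j * ∏ i ∈ A, F i) := by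
      refine associated_of_associated_coe hb0 ?_ ?_
      · rw [← Finset.prod_insert hjA]
        exact hF.unitAtZero_prod _
      · rw [hr]
        simpa using hA.mul_left (F j : ℚ[X])
    have hbirr := hL b (Multiset.mem_cons_self _ _)
    have hAu : IsUnit (∏ i ∈ A, F i) :=
      ((hbA.irreducible hbirr).isUnit_or_isUnit rfl).resolve_left (hF.irreducible j).not_isUnit
    have hbj : Associated b (F j) := hbA.trans (associated_mul_unit_left _ _ hAu)
    have hLJ : Associated L.prod (∏ i ∈ J, F i) := hprod.of_mul_left hbj hbirr.ne_zero
    rw [Multiset.map_cons, ih (fun g hg => hL g (Multiset.mem_cons_of_mem hg)) hLJ,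
      Associates.mk_eq_mk_iff_associated.mpr hbj, Finset.insert_val_of_notMem hj]
    simp

theorem quot_union [DecidableEq ι] {I A : Finset ι} {x : IntValued}
    (hx : (x : ℚ[X]) = quot p F I) (hIA : Disjoint I A) :
    ((x * ∏ i ∈ A, F i : IntValued) : ℚ[X]) = quot p F (I ∪ A) := by
  simp [hx, quot, Finset.prod_union hIA, mul_assoc]

/-- If the integrality of `quot p F A` is governed by two complementary index sets, then
`quot p F univ` has exactly the two corresponding factorizations. -/
theorem map_mk_eq_or_of_prod_eq [DecidableEq ι] [Fintype ι] (hF : IsNormalizedFamily F)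
    (hp : p ≠ 0) {I : Finset ι}
    (hcov : ∀ A, quot p F A ∈ IntValued → I ⊆ A ∨ Iᶜ ⊆ A) {x y : IntValued}
    (hx : (x : ℚ[X]) = quot p F I) (hy : (y : ℚ[X]) = quot p F Iᶜ) {L : Multiset IntValued}
    (hL : ∀ g ∈ L, Irreducible g) (hprod : (L.prod : ℚ[X]) = quot p F Finset.univ) :
    L.map Associates.mk = (x ::ₘ Iᶜ.val.map F).map Associates.mk ∨
      L.map Associates.mk = (y ::ₘ I.val.map F).map Associates.mk := by
  have hdvd : X + C (p : ℚ) ∣ (L.map Subtype.val).prod := by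
    rw [← coe_multiset_prod, hprod]
    exact linear_dvd_quot _
  obtain ⟨_, ha, hpa⟩ := (irreducible_linear p).prime.exists_mem_multiset_dvd hdvd
  obtain ⟨a, haL, rfl⟩ := Multiset.mem_map.mp ha
  obtain ⟨L, rfl⟩ := Multiset.exists_cons_of_mem haL
  have hairr := hL a (Multiset.mem_cons_self _ _)
  obtain ⟨A, -, z, hz, haz⟩ := hF.exists_associated_quot hp hprod
    (by rw [Multiset.prod_cons]; exact dvd_mul_right _ _) hpa
  have key {J : Finset ι} {w : IntValued} (hJA : J ⊆ A) (hw : (w : ℚ[X]) = quot p F J) :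
      (a ::ₘ L).map Associates.mk = (w ::ₘ Jᶜ.val.map F).map Associates.mk := by
    have hzw : z = w * ∏ i ∈ A \ J, F i := Subtype.ext <| by
      rw [quot_union hw Finset.disjoint_sdiff, Finset.union_sdiff_of_subset hJA, hz]
    have hu : IsUnit (∏ i ∈ A \ J, F i) :=
      ((haz.irreducible hairr).isUnit_or_isUnit hzw).resolve_left (quot_not_isUnit hw)
    have haw : Associated a w := haz.trans (hzw ▸ associated_mul_unit_left _ _ hu)
    have hLw : a * L.prod = w * ∏ i ∈ Jᶜ, F i := Subtype.ext <| by
      rw [quot_union hw disjoint_compl_right, Finset.union_compl, ← hprod, Multiset.prod_cons]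
    have hLJ : Associated L.prod (∏ i ∈ Jᶜ, F i) :=
      (Associated.of_eq hLw).of_mul_left haw hairr.ne_zero
    rw [Multiset.map_cons, Multiset.map_cons, Associates.mk_eq_mk_iff_associated.mpr haw,
      hF.map_mk_eq_of_associated_prod Jᶜ (fun g hg => hL g (Multiset.mem_cons_of_mem hg)) hLJ]
  rcases hcov A (hz ▸ z.2) with h | h
  · exact .inl (key h hx)
  · right
    simpa using key h hy

theorem natDegree_quot (hF : IsNormalizedFamily F) (hp : p ≠ 0) {A : Finset ι} {d : ℕ}
    (hd : ∀ i ∈ A, (F i : ℚ[X]).natDegree = d) : (quot p F A).natDegree = 1 + A.card * d := by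
  rw [quot, natDegree_C_mul (by simp [hp]),
    natDegree_mul (irreducible_linear p).ne_zero (hF.coe_prod_ne_zero A), natDegree_X_add_C,
    natDegree_prod _ _ fun i _ => (hF.irreducible_coe i).ne_zero, Finset.sum_congr rfl hd]
  simp

end IsNormalizedFamily

theorem natDegree_eq_of_associated {a b : IntValued} (h : Associated a b) :
    (a : ℚ[X]).natDegree = (b : ℚ[X]).natDegree :=
  natDegree_eq_of_degree_eq (degree_eq_degree_of_associated (associated_coe h))

section Construction

/-- A polynomial whose mirror image is irreducible is irreducible. -/
theorem irreducible_of_irreducible_mirror {R : Type*} [CommRing R] [IsDomain R] {f : R[X]}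
    (h : Irreducible f.mirror) : Irreducible f := by
  have key {a : R[X]} (ha : IsUnit a.mirror) : IsUnit a := by
    obtain ⟨c, hc, hca⟩ := Polynomial.isUnit_iff.mp ha
    rw [← a.mirror_mirror, ← hca, mirror_C]
    exact isUnit_C.mpr hc
  refine ⟨fun hu => h.not_isUnit ?_, fun a b hab => ?_⟩
  · obtain ⟨c, hc, rfl⟩ := Polynomial.isUnit_iff.mp hu
    rw [mirror_C]
    exact isUnit_C.mpr hc
  · exact (h.isUnit_or_isUnit (by rw [hab, mirror_mul_of_domain])).imp key key

/-- Eisenstein's criterion at `2`, applied to the mirror image. -/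
theorem irreducible_of_mirror_eisenstein {f : ℤ[X]} (h0 : f.coeff 0 = 1)
    (hpos : 0 < f.natDegree) (heven : ∀ k, 0 < k → 2 ∣ f.coeff k)
    (hlead : ¬ 4 ∣ f.leadingCoeff) : Irreducible f := by
  have hf : f ≠ 0 := by
    rintro rfl
    simp at h0
  have htr : f.natTrailingDegree = 0 :=
    natTrailingDegree_eq_zero.mpr (.inr (by simp [h0]))
  have hcoeff (k : ℕ) (hk : k ≤ f.natDegree) : f.mirror.coeff k = f.coeff (f.natDegree - k) := by
    rw [coeff_mirror, htr, add_zero, revAt_le hk]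
  have hlc : f.mirror.leadingCoeff = 1 := by
    rw [mirror_leadingCoeff, trailingCoeff, htr, h0]
  refine irreducible_of_irreducible_mirror ?_
  refine irreducible_of_eisenstein_criterion (P := Ideal.span {2})
    ((Ideal.span_singleton_prime two_ne_zero).mpr Int.prime_two) ?_ ?_ ?_ ?_
    (Monic.isPrimitive hlc)
  · rw [hlc, Ideal.mem_span_singleton]
    norm_num
  · intro k hk
    have hk' : k < f.natDegree := by
      rw [← f.mirror_natDegree]
      rwa [degree_eq_natDegree (mt mirror_eq_zero.mp hf), Nat.cast_lt] at hk
    rw [hcoeff k hk'.le, Ideal.mem_span_singleton]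
    exact heven _ (by omega)
  · rw [← natDegree_pos_iff_degree_pos, mirror_natDegree]
    exact hpos
  · rw [hcoeff 0 (Nat.zero_le _), Ideal.span_singleton_pow, Ideal.mem_span_singleton]
    simpa using hlead

variable {p : ℕ}

/-- An integer polynomial whose roots modulo `p` are the inverses of the elements of `T`. -/
noncomputable def locator (T : Finset (ZMod p)ˣ) : ℤ[X] :=
  ∏ t ∈ T, (1 - C (((t : ZMod p).val : ℕ) : ℤ) * X)

theorem coeff_zero_locator (T : Finset (ZMod p)ˣ) : (locator T).coeff 0 = 1 := by
  simp [locator, coeff_zero_eq_eval_zero, eval_prod]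

theorem natDegree_locator_le (T : Finset (ZMod p)ˣ) : (locator T).natDegree ≤ T.card := by
  refine (natDegree_prod_le _ _).trans ?_
  rw [Finset.card_eq_sum_ones]
  refine Finset.sum_le_sum fun t _ => ?_
  refine (natDegree_sub_le _ _).trans ?_
  simpa using natDegree_C_mul_le (((t : ZMod p).val : ℕ) : ℤ) X

theorem eval_locator [NeZero p] (T : Finset (ZMod p)ˣ) (c : ℤ) :
    ((((locator T).eval c : ℤ)) : ZMod p) = ∏ t ∈ T, (1 - (t : ZMod p) * c) := by
  simp [locator, eval_prod, -ZMod.natCast_val, ZMod.natCast_zmod_val]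

/-- A modification of `locator T` of degree `N` that is irreducible over `ℚ`. -/
noncomputable def intFactor (T : Finset (ZMod p)ˣ) (N : ℕ) : ℤ[X] :=
  1 + C ((p : ℤ) + 1) * (locator T - 1) + C (2 * (p : ℤ)) * X ^ N

theorem eval_intFactor [NeZero p] (T : Finset (ZMod p)ˣ) (N : ℕ) (c : ℤ) :
    (((intFactor T N).eval c : ℤ) : ZMod p) = ∏ t ∈ T, (1 - (t : ZMod p) * c) := by
  rw [← eval_locator]
  simp [intFactor]

theorem coeff_intFactor (T : Finset (ZMod p)ˣ) (N : ℕ) {k : ℕ} (hk : k ≠ 0) :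
    (intFactor T N).coeff k =
      ((p : ℤ) + 1) * (locator T).coeff k + if k = N then 2 * (p : ℤ) else 0 := by
  rw [intFactor, coeff_add, coeff_add, coeff_C_mul, coeff_C_mul, coeff_sub]
  simp [coeff_one, hk, coeff_X_pow]

theorem coeff_zero_intFactor (T : Finset (ZMod p)ˣ) {N : ℕ} (hN : N ≠ 0) :
    (intFactor T N).coeff 0 = 1 := by
  simp [intFactor, coeff_zero_locator, coeff_X_pow, hN.symm, -map_add, -map_mul]

theorem natDegree_intFactor [NeZero p] (T : Finset (ZMod p)ˣ) {N : ℕ} (hN : T.card < N) :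
    (intFactor T N).natDegree = N := by
  have hp : (p : ℤ) ≠ 0 := by exact_mod_cast NeZero.ne p
  refine natDegree_eq_of_le_of_coeff_ne_zero ?_ ?_
  · refine natDegree_le_iff_coeff_eq_zero.mpr fun k hk => ?_
    rw [coeff_intFactor T N (by omega), if_neg (by omega), coeff_eq_zero_of_natDegree_lt]
    · simp
    · have := natDegree_locator_le T
      omega
  · rw [coeff_intFactor T N (by omega), if_pos rfl, coeff_eq_zero_of_natDegree_lt]
    · simpa using hp
    · have := natDegree_locator_le T
      omega

theorem irreducible_intFactor (hp : Odd p) (T : Finset (ZMod p)ˣ) {N : ℕ}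
    (hN : T.card < N) : Irreducible (intFactor T N) := by
  have : NeZero p := ⟨by rintro rfl; simp at hp⟩
  have hdeg := natDegree_intFactor T hN
  obtain ⟨l, rfl⟩ := hp
  refine irreducible_of_mirror_eisenstein (coeff_zero_intFactor T (by omega)) (by omega) ?_ ?_
  · intro k hk
    rw [coeff_intFactor T N hk.ne']
    have heven : (2 : ℤ) ∣ (2 * l + 1 : ℕ) + 1 := ⟨l + 1, by push_cast; ring⟩
    refine dvd_add (heven.mul_right _) ?_
    split_ifs <;> simp
  · rw [leadingCoeff, hdeg, coeff_intFactor T N (by omega), if_pos rfl,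
      coeff_eq_zero_of_natDegree_lt (by have := natDegree_locator_le T; omega)]
    push_cast
    omega

/-- `intFactor T N` as an integer-valued polynomial. -/
noncomputable def factor (T : Finset (ZMod p)ˣ) (N : ℕ) : IntValued :=
  ⟨(intFactor T N).map (Int.castRingHom ℚ), fun c => ⟨(intFactor T N).eval c, by simp⟩⟩

theorem eval_factor (T : Finset (ZMod p)ˣ) (N : ℕ) (c : ℤ) :
    (factor T N : ℚ[X]).eval (c : ℚ) = ((intFactor T N).eval c : ℤ) := by
  simp [factor]

theorem natDegree_factor [NeZero p] (T : Finset (ZMod p)ˣ) {N : ℕ} (hN : T.card < N) :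
    (factor T N : ℚ[X]).natDegree = N :=
  (natDegree_map_eq_of_injective (Int.castRingHom ℚ).injective_int _).trans
    (natDegree_intFactor T hN)

theorem isNormalizedFamily_factor {ι : Type*} (hp : Odd p) (T : ι → Finset (ZMod p)ˣ)
    (N : ι → ℕ) (hN : ∀ i, (T i).card < N i) :
    IsNormalizedFamily fun i => factor (T i) (N i) where
  irreducible_coe i := by
    have h := irreducible_intFactor hp (T i) (hN i)
    have hpos : (intFactor (T i) (N i)).natDegree ≠ 0 := by
      have : NeZero p := ⟨by rintro rfl; simp at hp⟩
      rw [natDegree_intFactor _ (hN i)]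
      have := hN i
      omega
    exact (IsPrimitive.Int.irreducible_iff_irreducible_map_cast (h.isPrimitive hpos)).mp h
  eval_zero i := by
    have h := eval_factor (T i) (N i) 0
    rw [← coeff_zero_eq_eval_zero, coeff_zero_intFactor _ (by have := hN i; omega)] at h
    simpa using h

theorem quot_factor_mem_iff [Fact p.Prime] {ι : Type*} (T : ι → Finset (ZMod p)ˣ) (N : ι → ℕ)
    (A : Finset ι) :
    quot p (fun i => factor (T i) (N i)) A ∈ IntValued ↔
      ∀ t : (ZMod p)ˣ, ∃ i ∈ A, t ∈ T i := by
  have hp : (p : ℚ) ≠ 0 := by exact_mod_cast (Fact.out : p.Prime).ne_zero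
  have heval (c : ℤ) : (quot p (fun i => factor (T i) (N i)) A).eval (c : ℚ) =
      (p : ℚ)⁻¹ * (((c + p) * ∏ i ∈ A, (intFactor (T i) (N i)).eval c : ℤ) : ℚ) := by
    simp [quot, eval_prod, eval_factor]
  have hmem : quot p (fun i => factor (T i) (N i)) A ∈ IntValued ↔
      ∀ c : ℤ, (c : ZMod p) = 0 ∨ ∃ i ∈ A, ∃ t ∈ T i, 1 - (t : ZMod p) * c = 0 := by
    refine forall_congr' fun c => ?_
    have h := ZMod.intCast_zmod_eq_zero_iff_dvd
      ((c + p) * ∏ i ∈ A, (intFactor (T i) (N i)).eval c) p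
    simp only [Int.cast_mul, Int.cast_add, Int.cast_natCast, CharP.cast_eq_zero, add_zero,
      Int.cast_prod, eval_intFactor, mul_eq_zero, Finset.prod_eq_zero_iff] at h
    rw [h, heval, dvd_def]
    refine exists_congr fun m => ?_
    rw [inv_mul_eq_iff_eq_mul₀ hp]
    exact_mod_cast Iff.rfl
  rw [hmem]
  constructor
  · intro h t
    obtain ⟨c, hc⟩ := ZMod.intCast_surjective ((t⁻¹ : (ZMod p)ˣ) : ZMod p)
    rcases h c with h | ⟨i, hi, s, hs, hsc⟩
    · exact absurd (hc.symm.trans h) (Units.ne_zero _)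
    · rw [hc, sub_eq_zero, ← Units.val_mul, eq_comm, Units.val_eq_one, mul_inv_eq_one] at hsc
      exact ⟨i, hi, hsc ▸ hs⟩
  · intro h c
    refine or_iff_not_imp_left.mpr fun hc => ?_
    obtain ⟨i, hi, ht⟩ := h (Units.mk0 (c : ZMod p) hc)⁻¹
    exact ⟨i, hi, _, ht, by simp [hc]⟩

/-- A map from the units modulo `p` onto a grid makes the lines of the grid a family for which
the integrality of `quot` is governed by the two directions. -/
theorem forall_exists_mem_line_iff {α β γ : Type*} [Fintype α] [DecidableEq β] [DecidableEq γ]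
    {σ : α → β × γ} (hσ : σ.Surjective) (A : Finset (β ⊕ γ)) :
    (∀ t, ∃ i ∈ A, t ∈ Sum.elim (fun b => Finset.univ.filter fun t => (σ t).1 = b)
      (fun c => Finset.univ.filter fun t => (σ t).2 = c) i) ↔
      (∀ b, .inl b ∈ A) ∨ ∀ c, .inr c ∈ A := by
  simp only [Sum.exists, Sum.elim_inl, Sum.elim_inr, Finset.mem_filter, Finset.mem_univ,
    true_and, exists_eq_right']
  constructor
  · intro h
    by_contra! ⟨⟨b, hb⟩, c, hc⟩
    obtain ⟨t, ht⟩ := hσ (b, c)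
    simpa [ht, hb, hc] using h t
  · rintro (h | h) t
    · exact .inl (h _)
    · exact .inr (h _)

end Construction

end IntValued

/-- For `1 ≤ m ≤ n` there is `H ∈ Int(ℤ)` with a factorization into `m + 1`
irreducibles and an essentially different one into `n + 1` irreducibles, and no
other essentially different factorization. -/
theorem two_prescribed_factorizations (m n : ℕ) (hm : 1 ≤ m) (hmn : m ≤ n) :
    ∃ H : IntValued, ∃ M₁ M₂ : Multiset IntValued,
      (∀ g ∈ M₁, Irreducible g) ∧ (∀ g ∈ M₂, Irreducible g) ∧
      Multiset.card M₁ = m + 1 ∧ Multiset.card M₂ = n + 1 ∧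
      M₁.prod = H ∧ M₂.prod = H ∧
      M₁.map Associates.mk ≠ M₂.map Associates.mk ∧
      (∀ L : Multiset IntValued, (∀ g ∈ L, Irreducible g) → L.prod = H →
        L.map Associates.mk = M₁.map Associates.mk ∨
          L.map Associates.mk = M₂.map Associates.mk) := by
  obtain ⟨p, hpge, hp⟩ := Nat.exists_infinite_primes (n * m + 2)
  have : Fact p.Prime := ⟨hp⟩
  have : NeZero m := ⟨by omega⟩
  have : NeZero n := ⟨by omega⟩
  have hnm : 0 < n * m := Nat.mul_pos (by omega) hm
  have hodd : Odd p := hp.odd_of_ne_two (by omega)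
  obtain ⟨e⟩ : Nonempty (Fin n × Fin m ↪ (ZMod p)ˣ) :=
    Function.Embedding.nonempty_of_card_le (by simp [ZMod.card_units p]; omega)
  have hσ : (Function.invFun e).Surjective := Function.invFun_surjective e.injective
  let T : Fin n ⊕ Fin m → Finset (ZMod p)ˣ :=
    Sum.elim (fun b => Finset.univ.filter fun t => (Function.invFun e t).1 = b)
      (fun c => Finset.univ.filter fun t => (Function.invFun e t).2 = c)
  let N : Fin n ⊕ Fin m → ℕ := Sum.elim (fun _ => p + 1) (fun _ => p)
  have hT (i) : (T i).card < p := by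
    have h := Finset.card_le_univ (T i)
    rw [ZMod.card_units p] at h
    have := hp.pos
    omega
  have hN (i) : (T i).card < N i := (hT i).trans_le (by rcases i with i | i <;> simp [N])
  let F : Fin n ⊕ Fin m → IntValued := fun i => IntValued.factor (T i) (N i)
  have hF : IntValued.IsNormalizedFamily F := IntValued.isNormalizedFamily_factor hodd T N hN
  have hdeg (i) : (F i : ℚ[X]).natDegree = N i := IntValued.natDegree_factor (T i) (hN i)
  let I : Finset (Fin n ⊕ Fin m) := Finset.univ.map .inl
  have hI : Iᶜ = Finset.univ.map .inr := by
    ext (i | i) <;> simp [I]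
  have hcov (A) : IntValued.quot p F A ∈ IntValued ↔ I ⊆ A ∨ Iᶜ ⊆ A := by
    rw [hI, IntValued.quot_factor_mem_iff, IntValued.forall_exists_mem_line_iff hσ]
    simp [I, Finset.subset_iff]
  have hInot : ¬ I ⊆ Iᶜ := fun h => by
    simpa [I] using h (show Sum.inl 0 ∈ I by simp [I])
  have hInot' : ¬ Iᶜ ⊆ I := fun h => by
    simpa [I] using h (show Sum.inr 0 ∈ Iᶜ by simp [I])
  let x : IntValued := ⟨_, (hcov I).mpr (.inl subset_rfl)⟩
  let y : IntValued := ⟨_, (hcov Iᶜ).mpr (.inr subset_rfl)⟩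
  have hx : Irreducible x := hF.irreducible_quot hp.ne_zero rfl fun A hA h =>
    ((hcov A).mp h).elim hA.antisymm fun h => absurd (h.trans hA) hInot'
  have hy : Irreducible y := hF.irreducible_quot hp.ne_zero rfl fun A hA h =>
    ((hcov A).mp h).elim (fun h => absurd (h.trans hA) hInot) hA.antisymm
  have hxprod : ((x * ∏ i ∈ Iᶜ, F i : IntValued) : ℚ[X]) = IntValued.quot p F Finset.univ := by
    rw [IntValued.IsNormalizedFamily.quot_union rfl disjoint_compl_right, Finset.union_compl]
  have hyprod : ((y * ∏ i ∈ I, F i : IntValued) : ℚ[X]) = IntValued.quot p F Finset.univ := by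
    rw [IntValued.IsNormalizedFamily.quot_union rfl disjoint_compl_left, Finset.union_comm,
      Finset.union_compl]
  refine ⟨⟨_, (hcov Finset.univ).mpr (.inl (Finset.subset_univ _))⟩, x ::ₘ Iᶜ.val.map F,
    y ::ₘ I.val.map F, ?_, ?_, ?_, ?_, ?_, ?_, ?_, ?_⟩
  · exact Multiset.forall_mem_cons.mpr ⟨hx, Multiset.forall_mem_map_iff.mpr fun i _ =>
      hF.irreducible i⟩
  · exact Multiset.forall_mem_cons.mpr ⟨hy, Multiset.forall_mem_map_iff.mpr fun i _ =>
      hF.irreducible i⟩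
  · simp [hI]
  · simp [I]
  · rw [Multiset.prod_cons]
    exact Subtype.ext hxprod
  · rw [Multiset.prod_cons]
    exact Subtype.ext hyprod
  · intro h
    have hxd : (x : ℚ[X]).natDegree = 1 + n * (p + 1) := by
      rw [hF.natDegree_quot hp.ne_zero (d := p + 1) (by simp [I, hdeg, N])]
      simp [I]
    have hyd : (y : ℚ[X]).natDegree = 1 + m * p := by
      rw [hF.natDegree_quot hp.ne_zero (d := p) (by simp [hI, hdeg, N])]
      simp [hI]
    have hmem : Associates.mk y ∈ (x ::ₘ Iᶜ.val.map F).map Associates.mk := by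
      rw [h]
      simp
    obtain ⟨z, hz, hzy⟩ := Multiset.mem_map.mp hmem
    have hzd := IntValued.natDegree_eq_of_associated (Associates.mk_eq_mk_iff_associated.mp hzy)
    rw [hyd] at hzd
    rcases Multiset.mem_cons.mp hz with rfl | hz
    · rw [hxd] at hzd
      nlinarith [Nat.mul_le_mul_right p hmn]
    · obtain ⟨i, hi, rfl⟩ := Multiset.mem_map.mp hz
      rw [hI] at hi
      obtain ⟨j, -, rfl⟩ := Finset.mem_map.mp (Finset.mem_val.mp hi)
      rw [hdeg] at hzd
      simp only [N, Function.Embedding.inr_apply, Sum.elim_inr] at hzd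
      nlinarith
  · intro L hL hprod
    exact hF.map_mk_eq_or_of_prod_eq hp.ne_zero (fun A => (hcov A).mp) rfl rfl hL
      (congrArg Subtype.val hprod)
end

section
/- Let I be a finite nonempty index set, gᵢ ∈ ℤ[X] primitive and irreducible in ℤ[X] for i ∈ I, and let a ∈ ℤ, b ∈ ℕ with b ≥ 1 and gcd(a, b) = 1 be such that f = (a/b) · ∏_{i∈I} gᵢ is a non-constant element of Int(ℤ). Then f is irreducible in Int(ℤ) if and only if: a = ±1, b equals the fixed divisor d(∏_{i∈I} gᵢ), and there is no nonempty proper subset J ⊊ I together with b₁, b₂ ∈ ℕ such that b₁ · b₂ = b, b₁ = d(∏_{i∈J} gᵢ), and b₂ = d(∏_{i∈I∖J} gᵢ). -/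
open Polynomial

/-- The fixed divisor `d(f)` of `f ∈ ℤ[X]`: the nonnegative generator of the
ideal of ℤ generated by the image `f(ℤ)`. -/
noncomputable def fixedDivisor (f : Polynomial ℤ) : ℕ :=
  (@Submodule.IsPrincipal.generator ℤ ℤ _ _ _
    (Ideal.span (Set.range fun c : ℤ => f.eval c))
    (IsPrincipalIdealRing.principal _)).natAbs

theorem dvd_fixedDivisor_iff {n : ℕ} {p : ℤ[X]} :
    n ∣ fixedDivisor p ↔ ∀ c : ℤ, (n : ℤ) ∣ p.eval c := by
  rw [fixedDivisor, ← Int.natCast_dvd, ← Ideal.span_singleton_le_span_singleton,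
    Ideal.span_singleton_generator, Ideal.span_le]
  simp [Set.range_subset_iff, Ideal.mem_span_singleton]

theorem fixedDivisor_dvd_eval (p : ℤ[X]) (c : ℤ) : (fixedDivisor p : ℤ) ∣ p.eval c :=
  dvd_fixedDivisor_iff.1 dvd_rfl c

theorem fixedDivisor_ne_zero {p : ℤ[X]} (hp : p ≠ 0) : fixedDivisor p ≠ 0 := by
  intro h
  refine hp (Polynomial.funext fun c => ?_)
  simpa [h] using fixedDivisor_dvd_eval p c

theorem fixedDivisor_one : fixedDivisor 1 = 1 := by
  simpa [Int.natCast_dvd] using fixedDivisor_dvd_eval 1 0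

theorem fixedDivisor_mul_dvd (p q : ℤ[X]) :
    fixedDivisor p * fixedDivisor q ∣ fixedDivisor (p * q) := by
  refine dvd_fixedDivisor_iff.2 fun c => ?_
  rw [eval_mul, Nat.cast_mul]
  exact mul_dvd_mul (fixedDivisor_dvd_eval p c) (fixedDivisor_dvd_eval q c)

namespace IntValued

theorem C_div_mul_map_mem_iff {a : ℤ} {b : ℕ} (hb : b ≠ 0) (hab : IsCoprime a (b : ℤ))
    (p : ℤ[X]) :
    C ((a : ℚ) / (b : ℚ)) * p.map (Int.castRingHom ℚ) ∈ IntValued ↔ b ∣ fixedDivisor p := by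
  have hb' : (b : ℚ) ≠ 0 := Nat.cast_ne_zero.2 hb
  rw [dvd_fixedDivisor_iff]
  refine forall_congr' fun c => ?_
  have heval : (p.map (Int.castRingHom ℚ)).eval (c : ℚ) = (p.eval c : ℤ) := by
    simp
  have hdvd : (b : ℤ) ∣ p.eval c ↔ (b : ℤ) ∣ a * p.eval c :=
    ⟨fun h => h.mul_left a, hab.symm.dvd_of_dvd_mul_left⟩
  rw [hdvd, eval_mul, eval_C, heval]
  refine exists_congr fun m => ?_
  rw [div_mul_eq_mul_div, div_eq_iff hb', mul_comm (m : ℚ)]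
  exact_mod_cast Iff.rfl

theorem den_dvd_fixedDivisor {q : ℚ} {p : ℤ[X]}
    (h : C q * p.map (Int.castRingHom ℚ) ∈ IntValued) : q.den ∣ fixedDivisor p := by
  rw [← Rat.num_div_den q] at h
  exact (C_div_mul_map_mem_iff q.den_nz q.isCoprime_num_den p).1 h

theorem C_inv_mul_map_mem {b : ℕ} (hb : b ≠ 0) {p : ℤ[X]} (h : b ∣ fixedDivisor p) :
    C ((b : ℚ)⁻¹) * p.map (Int.castRingHom ℚ) ∈ IntValued := by
  simpa using (C_div_mul_map_mem_iff (a := 1) hb isCoprime_one_left p).2 h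

theorem natDegree_eq_zero_of_isUnit {f : IntValued} (hf : IsUnit f) :
    (f : ℚ[X]).natDegree = 0 :=
  Polynomial.natDegree_eq_zero_of_isUnit (hf.map IntValued.subtype)

theorem isUnit_intCast_iff {m : ℤ} : IsUnit (m : IntValued) ↔ IsUnit m := by
  refine ⟨fun h => ?_, fun h => h.map (Int.castRingHom IntValued)⟩
  obtain ⟨u, hu⟩ := h.exists_right_inv
  obtain ⟨n, hn⟩ := u.2 0
  have h0 := congrArg (fun v : IntValued => (v : ℚ[X]).eval ((0 : ℤ) : ℚ)) hu
  simp only [Subring.coe_mul, Subring.coe_intCast, Subring.coe_one, eval_mul, eval_intCast,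
    eval_one, hn] at h0
  exact .of_mul_eq_one n (by exact_mod_cast h0)

theorem isUnit_of_coe_eq_C {f : IntValued} {q : ℚ} (hf : (f : ℚ[X]) = C q) (hden : q.den = 1)
    (hnum : IsUnit q.num) : IsUnit f := by
  have : f = (q.num : IntValued) := Subtype.ext <| by
    rw [hf, Subring.coe_intCast, ← map_intCast (C : ℚ →+* ℚ[X]),
      Rat.coe_int_num_of_den_eq_one hden]
  exact this ▸ isUnit_intCast_iff.2 hnum

end IntValued

theorem natDegree_C_mul_map_prod_pos {ι : Type*} {J : Finset ι} (hJ : J.Nonempty) {g : ι → ℤ[X]}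
    (hg : ∀ i ∈ J, 0 < (g i).natDegree) {q : ℚ} (hq : q ≠ 0) :
    0 < (C q * (∏ i ∈ J, g i).map (Int.castRingHom ℚ)).natDegree := by
  rw [natDegree_C_mul hq, natDegree_map_eq_of_injective Int.cast_injective, natDegree_prod]
  · exact Finset.sum_pos hg hJ
  · exact fun i hi => ne_zero_of_natDegree_gt (hg i hi)

theorem Rat.num_isUnit_and_den_eq_of_mul_eq {q r : ℚ} {a : ℤ} {b m n : ℕ} (ha : IsUnit a)
    (hb : b ≠ 0) (hqr : (a : ℚ) / b = q * r) (hq : q.den ∣ m) (hr : r.den ∣ n)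
    (hmn : m * n ∣ b) :
    IsUnit q.num ∧ IsUnit r.num ∧ q.den = m ∧ r.den = n ∧ m * n = b := by
  have key : a * (q.den * r.den : ℕ) = q.num * r.num * b := by
    have hb' : (b : ℚ) ≠ 0 := Nat.cast_ne_zero.2 hb
    have hqd : (q.den : ℚ) ≠ 0 := Nat.cast_ne_zero.2 q.den_nz
    have hrd : (r.den : ℚ) ≠ 0 := Nat.cast_ne_zero.2 r.den_nz
    rw [← Rat.num_div_den q, ← Rat.num_div_den r] at hqr
    field_simp at hqr
    push_cast [← @Int.cast_inj ℚ]
    linarith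
  have hden : q.den * r.den ∣ m * n := mul_dvd_mul hq hr
  have hbd : b ∣ q.den * r.den := by
    rw [← Int.natCast_dvd_natCast, ← ha.dvd_mul_left, key]
    exact dvd_mul_left _ _
  have hden_eq : q.den * r.den = b := Nat.dvd_antisymm (hden.trans hmn) hbd
  have hmn_eq : m * n = b := Nat.dvd_antisymm hmn (hbd.trans hden)
  rw [hden_eq] at key
  have hnum : IsUnit (q.num * r.num) :=
    mul_right_cancel₀ (Int.natCast_ne_zero.2 hb) key ▸ ha
  have hm : 0 < m := Nat.pos_of_ne_zero fun h => hb (by rw [← hmn_eq, h, zero_mul])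
  have hn : 0 < n := Nat.pos_of_ne_zero fun h => hb (by rw [← hmn_eq, h, mul_zero])
  obtain ⟨hqm, hrn⟩ := (mul_eq_mul_iff_eq_and_eq_of_pos (Nat.le_of_dvd hm hq)
    (Nat.le_of_dvd hn hr) q.den_pos hn).1 (hden_eq.trans hmn_eq.symm)
  exact ⟨isUnit_of_mul_isUnit_left hnum, isUnit_of_mul_isUnit_right hnum, hqm, hrn, hmn_eq⟩

/-- Remark 2 (ii): a non-constant `f = (a/b)·∏ᵢ gᵢ ∈ Int(ℤ)`, with the `gᵢ`
primitive and irreducible in ℤ[X] and `gcd(a,b) = 1`, is irreducible in `Int(ℤ)`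
iff `a = ±1`, `b = d(∏ᵢ gᵢ)`, and no nonempty proper subset `J ⊊ I` gives a
splitting `b = d(∏_{i∈J} gᵢ) · d(∏_{i∈I∖J} gᵢ)`. -/
theorem irreducible_iff_no_fixed_divisor_splitting
    {ι : Type*} [DecidableEq ι] (I : Finset ι) (hI : I.Nonempty)
    (g : ι → Polynomial ℤ)
    (hprim : ∀ i ∈ I, (g i).IsPrimitive) (hirr : ∀ i ∈ I, Irreducible (g i))
    (a : ℤ) (b : ℕ) (hb : 1 ≤ b) (hab : Int.gcd a b = 1)
    (f : IntValued)
    (hf : (f : Polynomial ℚ)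
        = Polynomial.C ((a : ℚ) / (b : ℚ)) * (∏ i ∈ I, g i).map (Int.castRingHom ℚ))
    (hnc : 0 < (f : Polynomial ℚ).natDegree) :
    Irreducible f ↔
      ((a = 1 ∨ a = -1) ∧ b = fixedDivisor (∏ i ∈ I, g i) ∧
        ¬∃ J : Finset ι, J ⊆ I ∧ J.Nonempty ∧ J ≠ I ∧
          fixedDivisor (∏ i ∈ J, g i) * fixedDivisor (∏ i ∈ I \ J, g i) = b) := by
  have hb0 : b ≠ 0 := Nat.one_le_iff_ne_zero.1 hb
  have hbQ : (b : ℚ) ≠ 0 := Nat.cast_ne_zero.2 hb0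
  have ha0 : a ≠ 0 := by
    rintro rfl
    simp [hf] at hnc
  have hprime : ∀ i ∈ I, Prime ((g i).map (Int.castRingHom ℚ)) := fun i hi =>
    ((IsPrimitive.Int.irreducible_iff_irreducible_map_cast (hprim i hi)).1 (hirr i hi)).prime
  have hdeg : ∀ i ∈ I, 0 < (g i).natDegree := fun i hi => by
    rw [← natDegree_map_eq_of_injective (f := Int.castRingHom ℚ) Int.cast_injective]
    exact (hprime i hi).irreducible.natDegree_pos
  have hbd : b ∣ fixedDivisor (∏ i ∈ I, g i) :=
    (IntValued.C_div_mul_map_mem_iff hb0 (Int.isCoprime_iff_gcd_eq_one.2 hab) _).1 (hf ▸ f.2)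
  constructor
  · intro hfirr
    have hd0 : fixedDivisor (∏ i ∈ I, g i) ≠ 0 :=
      fixedDivisor_ne_zero (Finset.prod_ne_zero_iff.2 fun i hi => (hirr i hi).ne_zero)
    have hnot : ∀ {J : Finset ι} (_ : J ⊆ I) (_ : J.Nonempty) {m : ℕ} (_ : m ≠ 0) (h),
        ¬IsUnit (⟨C ((m : ℚ)⁻¹) * (∏ i ∈ J, g i).map (Int.castRingHom ℚ), h⟩ : IntValued) :=
      fun hJI hJ _ hm _ hu => (natDegree_C_mul_map_prod_pos hJ (fun i hi => hdeg i (hJI hi))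
        (inv_ne_zero (Nat.cast_ne_zero.2 hm))).ne' (IntValued.natDegree_eq_zero_of_isUnit hu)
    have hak : IsUnit a ∧ b = fixedDivisor (∏ i ∈ I, g i) := by
      obtain ⟨k, hk⟩ := hbd
      have hkQ : (k : ℚ) ≠ 0 := Nat.cast_ne_zero.2 fun h => hd0 (by rw [hk, h, mul_zero])
      have hfac : f = ((a * k : ℤ) : IntValued) *
          ⟨_, IntValued.C_inv_mul_map_mem hd0 dvd_rfl⟩ := Subtype.ext <| by
        rw [hf, Subring.coe_mul, Subring.coe_intCast, ← map_intCast (C : ℚ →+* ℚ[X]),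
          ← mul_assoc, ← C_mul, hk]
        congr 2
        push_cast
        field_simp
      have hu := IntValued.isUnit_intCast_iff.1
        ((hfirr.isUnit_or_isUnit hfac).resolve_right (hnot subset_rfl hI hd0 _))
      have hk1 : k = 1 := by simpa [Int.isUnit_iff_natAbs_eq] using isUnit_of_mul_isUnit_right hu
      exact ⟨isUnit_of_mul_isUnit_left hu, by rw [hk, hk1, mul_one]⟩
    refine ⟨Int.isUnit_iff.1 hak.1, hak.2, ?_⟩
    rintro ⟨J, hJI, hJ, hJne, hsplit⟩
    have hJ' : (I \ J).Nonempty := Finset.sdiff_nonempty.2 fun h => hJne (hJI.antisymm h)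
    obtain ⟨h₁, h₂⟩ := mul_ne_zero_iff.1 (hsplit.trans_ne hb0)
    have hfac : f = (a : IntValued) * ⟨_, IntValued.C_inv_mul_map_mem h₁ dvd_rfl⟩ *
        ⟨_, IntValued.C_inv_mul_map_mem h₂ dvd_rfl⟩ := Subtype.ext <| by
      simp only [Subring.coe_mul, Subring.coe_intCast]
      rw [hf, ← Finset.prod_sdiff hJI, ← hsplit, Polynomial.map_mul, div_eq_mul_inv, C_mul,
        Nat.cast_mul, mul_inv, C_mul, map_intCast (C : ℚ →+* ℚ[X])]
      ring
    rcases hfirr.isUnit_or_isUnit hfac with hu | hu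
    · exact hnot hJI hJ h₁ _ (isUnit_of_mul_isUnit_right hu)
    · exact hnot Finset.sdiff_subset hJ' h₂ _ hu
  · rintro ⟨ha, hbeq, hno⟩
    refine ⟨fun hu => hnc.ne' (IntValued.natDegree_eq_zero_of_isUnit hu), fun {x y} hxy => ?_⟩
    have hxy' : (x : ℚ[X]) * y =
        C ((a : ℚ) / b) * ∏ i ∈ I, (g i).map (Int.castRingHom ℚ) := by
      rw [← Polynomial.map_prod, ← hf, hxy, Subring.coe_mul]
    obtain ⟨J, K, u, v, hJK, hdisj, huv, hx, hy⟩ := mul_eq_mul_prime_prod hprime hxy'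
    have huv_unit : IsUnit (u * v) :=
      huv ▸ isUnit_C.2 (div_ne_zero (Int.cast_ne_zero.2 ha0) hbQ).isUnit
    obtain ⟨q, -, rfl⟩ := isUnit_iff.1 (isUnit_of_mul_isUnit_left huv_unit)
    obtain ⟨r, -, rfl⟩ := isUnit_iff.1 (isUnit_of_mul_isUnit_right huv_unit)
    rw [← C_mul] at huv
    rw [← Polynomial.map_prod] at hx hy
    obtain ⟨hqu, hru, hqd, hrd, hmul⟩ := Rat.num_isUnit_and_den_eq_of_mul_eq
      (Int.isUnit_iff.2 ha) hb0 (C_injective huv)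
      (IntValued.den_dvd_fixedDivisor (hx ▸ x.2)) (IntValued.den_dvd_fixedDivisor (hy ▸ y.2))
      (by
        rw [hbeq, ← hJK, Finset.prod_union hdisj]
        exact fixedDivisor_mul_dvd _ _)
    rcases J.eq_empty_or_nonempty with rfl | hJ
    · refine .inl (IntValued.isUnit_of_coe_eq_C (by simpa using hx) ?_ hqu)
      rw [hqd, Finset.prod_empty, fixedDivisor_one]
    rcases K.eq_empty_or_nonempty with rfl | hK
    · refine .inr (IntValued.isUnit_of_coe_eq_C (by simpa using hy) ?_ hru)
      rw [hrd, Finset.prod_empty, fixedDivisor_one]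
    have hsdiff : I \ J = K := by rw [← hJK, Finset.union_sdiff_cancel_left hdisj]
    refine (hno ⟨J, hJK ▸ Finset.subset_union_left, hJ, fun h => ?_, hsdiff ▸ hmul⟩).elim
    rw [h, Finset.sdiff_self] at hsdiff
    exact hK.ne_empty hsdiff.symm
end
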